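/- arXiv:1111.1582 — 2 statements merged into one kernel-verified Lean document; each statement's English description precedes it below -/
import Mathlib

section
/- Let k be an algebraically closed field and Z ⊂ P^N_k a complete intersection of dimension n ≥ 1. Then Z is connected; if moreover Z is smooth, then Z is integral. -/
/-!
Statement 3: Let `Z ⊆ ℙ^N_k` be a complete intersection of dimension `n ≥ 1` over an
algebraically closed field. Then `Z` is connected; if moreover `Z` is smooth then `Z` is
integral.

We realize the underlying topological space of `Z` as the zero locus of the equations in the
projective spectrum `Proj k[X₀,…,X_N]`; connectedness of the scheme `Z` is connectedness of
this space.  Since a smooth scheme is reduced, integrality of a smooth `Z` amounts to the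
irreducibility of this space together with primality of the (then automatically saturated)
ideal `(F₁, …, F_c)`, i.e. integrality of the homogeneous coordinate ring.
Smoothness of `Z` is expressed by the Jacobian criterion (valid over the algebraically
closed field `k`).
-/

open MvPolynomial

attribute [local instance] MvPolynomial.gradedAlgebra

/-- Jacobian criterion: the scheme cut out by `F` in `ℙ^N` is smooth iff at every nonzero
point of the affine cone where all the `Fᵢ` vanish, the Jacobian matrix has rank `c`. -/
def JacobianSmooth {k : Type} [Field k] {N c : ℕ}
    (F : Fin c → MvPolynomial (Fin (N + 1)) k) : Prop :=
  ∀ x : Fin (N + 1) → k, x ≠ 0 → (∀ i, MvPolynomial.eval x (F i) = 0) →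
    Matrix.rank (Matrix.of fun (i : Fin c) (j : Fin (N + 1)) =>
      MvPolynomial.eval x (MvPolynomial.pderiv j (F i))) = c

section helpers

open IsLocalRing RingTheory.Sequence Module
open scoped Pointwise


lemma CI_isch {R : Type} [CommRing R] [IsLocalRing R] [IsNoetherianRing R] (rs : List R) :
    ∀ (M : Type) [AddCommGroup M] [Module R M] [Module.Finite R M], IsRegular M rs →
    ∀ p : Ideal R, IsAssociatedPrime p M → (rs.length : WithBot ℕ∞) ≤ ringKrullDim (R ⧸ p) := by
  induction rs with
  | nil =>
    intro M _ _ _ _ p hp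
    have := hp.isPrime
    have : Nontrivial (R ⧸ p) := Ideal.Quotient.nontrivial_iff.mpr hp.isPrime.ne_top
    simpa using ringKrullDim_nonneg_of_nontrivial
  | cons x rs ih =>
    intro M _ _ _ hreg p hp
    have mem : x ∈ maximalIdeal R := by
      simpa using fun isu ↦ hreg.2 (by simp [Ideal.span_singleton_eq_top.mpr isu])
    rw [isRegular_cons_iff] at hreg
    obtain ⟨hx, hreg⟩ := hreg
    have hpp := hp.isPrime
    -- the submodule killed by p
    let N : Submodule R M := 
      { carrier := {m | ∀ a ∈ p, a • m = 0}
        add_mem' := fun {a b} ha hb c hc => by rw [smul_add, ha c hc, hb c hc, add_zero]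
        zero_mem' := fun c _ => smul_zero c
        smul_mem' := fun r m hm c hc => by rw [smul_comm, hm c hc, smul_zero] }
    obtain ⟨u, hu, hux⟩ : ∃ u ∈ N, u ∉ (x • ⊤ : Submodule R M) := by
      by_contra! hcon
      have hle : N ≤ Ideal.span {x} • N := by
        intro m hm
        have h1 := hcon m hm
        rw [Submodule.mem_smul_pointwise_iff_exists] at h1
        obtain ⟨m', -, rfl⟩ := h1
        refine Submodule.smul_mem_smul (Ideal.mem_span_singleton_self x) ?_
        intro a ha
        have := hm a ha
        rw [smul_comm] at this
        exact hx (by simpa using this)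
      have hN : N = ⊥ := Submodule.eq_bot_of_le_smul_of_le_jacobson_bot (Ideal.span {x}) N
        (IsNoetherian.noetherian N) hle (by
          rw [IsLocalRing.jacobson_eq_maximalIdeal _ bot_ne_top]
          simpa [Ideal.span_le] using mem)
      obtain ⟨hp', m, hm⟩ := isAssociatedPrime_iff.mp hp
      have hmN : m ∈ N := by
        intro a ha
        rw [hm] at ha
        simpa [Submodule.mem_colon_singleton] using ha
      rw [hN, Submodule.mem_bot] at hmN
      apply hpp.ne_top
      rw [hm, hmN]
      simp
    have hu0 : (Submodule.Quotient.mk u : QuotSMulTop x M) ≠ 0 := by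
      rwa [ne_eq, Submodule.Quotient.mk_eq_zero]
    obtain ⟨q, hq, hle⟩ := exists_le_isAssociatedPrime_of_isNoetherianRing R _ hu0
    have hqp := hq.isPrime
    have hpq : p < q := by
      refine lt_of_le_of_ne ?_ ?_
      · intro a ha
        apply hle
        rw [Submodule.mem_colon_singleton, ← Submodule.Quotient.mk_smul, hu a ha]
        simp
      · rintro rfl
        have hxp : x ∈ p := by
          apply hle
          rw [Submodule.mem_colon_singleton, ← Submodule.Quotient.mk_smul, Submodule.mem_bot,
            Submodule.Quotient.mk_eq_zero]
          exact Submodule.smul_mem_pointwise_smul _ _ _ trivial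
        obtain ⟨hp', m, hm⟩ := isAssociatedPrime_iff.mp hp
        rw [hm, Submodule.mem_colon_singleton, Submodule.mem_bot] at hxp
        have : m = 0 := hx (by simpa using hxp)
        apply hpp.ne_top
        rw [hm, this]
        simp
    have h1 := ih _ hreg q hq
    have h2 : ringKrullDim (R ⧸ q) + 1 ≤ ringKrullDim (R ⧸ p) := by
      obtain ⟨a, haq, hap⟩ := Set.exists_of_ssubset hpq
      refine ringKrullDim_succ_le_of_surjective (Ideal.Quotient.factor hpq.le) 
        (Ideal.Quotient.factor_surjective hpq.le) (r := Ideal.Quotient.mk p a) ?_ ?_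
      · rw [mem_nonZeroDivisors_iff_ne_zero]
        rwa [ne_eq, Ideal.Quotient.eq_zero_iff_mem]
      · simpa [Ideal.Quotient.eq_zero_iff_mem] using haq
    rw [List.length_cons]
    push_cast
    exact le_trans (by gcongr) h2

open CategoryTheory Abelian in
lemma CI_exch {R : Type} [CommRing R] [IsLocalRing R] [IsNoetherianRing R] (n : ℕ)
    (M : Type) [AddCommGroup M] [Module R M] [Module.Finite R M] [Nontrivial M]
    (rs : List R) (hl : rs.length = n + 1)
    (hreg : IsRegular M rs) (x : R) (hxm : x ∈ maximalIdeal R) (hx : IsSMulRegular M x) :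
    ∃ rs' : List R, rs'.length = n ∧ IsRegular (QuotSMulTop x M) rs' := by
  have mem : ∀ r ∈ rs, r ∈ maximalIdeal R := by
    intro r hr
    by_contra hcon
    have hu : IsUnit r := by simpa using hcon
    apply hreg.2
    have : Ideal.ofList rs = ⊤ := Ideal.eq_top_of_isUnit_mem _ (Ideal.subset_span hr) hu
    simp [this]
  have lt : ∀ (M : Type) [AddCommGroup M] [Module R M] [Module.Finite R M] [Nontrivial M],
      maximalIdeal R • (⊤ : Submodule R M) < ⊤ := by
    intro M _ _ _ _
    refine lt_top_iff_ne_top.mpr fun h => ?_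
    refine (top_ne_bot : (⊤ : Submodule R M) ≠ ⊥) ?_
    exact Submodule.eq_bot_of_le_smul_of_le_jacobson_bot (maximalIdeal R) ⊤
        Module.Finite.fg_top h.ge (by
          rw [IsLocalRing.jacobson_eq_maximalIdeal _ bot_ne_top])
  have e1 := (ModuleCat.exists_isRegular_tfae (maximalIdeal R) (n+1) (ModuleCat.of R M)
    (lt M)).out 3 1
  have h1 := e1.mp ⟨rs, hl, mem, hreg⟩
  have : Nontrivial (QuotSMulTop x M) := nontrivial_quotSMulTop_of_mem_maximalIdeal M hxm
  have e2 := (ModuleCat.exists_isRegular_tfae (maximalIdeal R) n (ModuleCat.of R (QuotSMulTop x M))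
    (lt _)).out 1 3
  have h2 := e2.mp ?_
  · obtain ⟨rs', a, b, c⟩ := h2
    exact ⟨rs', a, c⟩
  · intro i hi
    have zero1 := AddCommGrpCat.isZero_of_iff_subsingleton.mpr (h1 i (by omega))
    have zero2 := AddCommGrpCat.isZero_of_iff_subsingleton.mpr (h1 (i + 1) (by omega))
    exact AddCommGrpCat.subsingleton_of_isZero <| ShortComplex.Exact.isZero_of_both_zeros
        ((Ext.covariant_sequence_exact₃' _ (IsSMulRegular.smulShortComplex_shortExact (M := ModuleCat.of R M) hx)) i (i + 1) rfl)
        (zero1.eq_zero_of_src _) (zero2.eq_zero_of_tgt _)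

lemma CI_supp {R : Type} [CommRing R] [IsLocalRing R] [IsNoetherianRing R] (rs : List R) :
    ∀ (M : Type) [AddCommGroup M] [Module R M] [Module.Finite R M], (∀ r ∈ rs, r ∈ maximalIdeal R) →
    supportDim R M ≤ supportDim R (M ⧸ Ideal.ofList rs • (⊤ : Submodule R M)) + rs.length := by
  induction rs with
  | nil =>
    intro M _ _ _ _
    rw [Ideal.ofList_nil, Submodule.bot_smul]
    simpa using (supportDim_eq_of_equiv (Submodule.quotEquivOfEqBot ⊥ rfl)).ge
  | cons x rs ih =>
    intro M _ _ _ h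
    rw [supportDim_eq_of_equiv (Submodule.quotOfListConsSMulTopEquivQuotSMulTopInner M x _)]
    refine (supportDim_le_supportDim_quotSMulTop_succ (h x (by simp))).trans ?_
    have := ih (QuotSMulTop x M) (fun r hr => h r (by simp [hr]))
    rw [List.length_cons]
    push_cast
    rw [← add_assoc]
    gcongr

/-- Cohen-Macaulay modules: cutting by parameters keeps them Cohen-Macaulay. -/
lemma CI_CM {R : Type} [CommRing R] [IsLocalRing R] [IsNoetherianRing R] (fs : List R) :
    ∀ (M : Type) [AddCommGroup M] [Module R M] [Module.Finite R M] [Nontrivial M] (n : ℕ),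
    (∃ rs : List R, rs.length = n + fs.length ∧ IsRegular M rs) → 
    (∀ r ∈ fs, r ∈ maximalIdeal R) → 
    supportDim R (M ⧸ Ideal.ofList fs • (⊤ : Submodule R M)) ≤ n →
    ∃ rs : List R, rs.length = n ∧ IsRegular (M ⧸ Ideal.ofList fs • (⊤ : Submodule R M)) rs := by
  induction fs with
  | nil =>
    intro M _ _ _ _ n ⟨rs, hl, hrs⟩ _ _ 
    refine ⟨rs, by simpa using hl, ?_⟩
    refine (LinearEquiv.isRegular_congr ?_ rs).mp hrs
    exact (Submodule.quotEquivOfEqBot _ (by rw [Ideal.ofList_nil, Submodule.bot_smul])).symm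
  | cons x fs ih =>
    intro M _ _ _ _ n ⟨rs, hl, hrs⟩ hmem hdim
    have hxm := hmem x (by simp)
    have hmem' : ∀ r ∈ fs, r ∈ maximalIdeal R := fun r hr => hmem r (by simp [hr])
    have : Nontrivial (QuotSMulTop x M) := nontrivial_quotSMulTop_of_mem_maximalIdeal M hxm
    rw [supportDim_eq_of_equiv (Submodule.quotOfListConsSMulTopEquivQuotSMulTopInner M x _)] at hdim
    have hd : supportDim R (QuotSMulTop x M) ≤ n + fs.length := 
      (CI_supp fs (QuotSMulTop x M) hmem').trans (by gcongr)
    have hx : IsSMulRegular M x := by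
      by_contra hcon
      have : x ∈ ⋃ p ∈ associatedPrimes R M, (p : Set R) := by
        rw [biUnion_associatedPrimes_eq_compl_regular]
        exact hcon
      simp only [Set.mem_iUnion] at this
      obtain ⟨p, hp, hxp⟩ := this
      have h1 := CI_isch rs M hrs p hp
      have hpp := hp.isPrime
      have h2 : ringKrullDim (R ⧸ p) ≤ supportDim R (QuotSMulTop x M) := by
        rw [supportDim_eq_ringKrullDim_quotient_annihilator]
        have hps : (⟨p, hpp⟩ : PrimeSpectrum R) ∈ Module.support R (QuotSMulTop x M) := by
          rw [support_quotSMulTop]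
          refine ⟨?_, by simpa using hxp⟩
          obtain ⟨hp', m, hm⟩ := isAssociatedPrime_iff.mp hp
          rw [Module.mem_support_iff_of_finite]
          intro a ha
          change a ∈ p
          rw [hm, Submodule.mem_colon_singleton, Submodule.mem_bot]
          exact Module.mem_annihilator.mp ha m
        have hle := Module.mem_support_iff_of_finite.mp hps
        exact ringKrullDim_le_of_surjective (Ideal.Quotient.factor hle) (Ideal.Quotient.factor_surjective hle)
      have h3 := (h1.trans h2).trans hd
      rw [hl, List.length_cons] at h3
      have : n + (fs.length + 1) ≤ n + fs.length := by exact_mod_cast h3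
      omega
    obtain ⟨rs', hl', hrs'⟩ := CI_exch (n + fs.length) M rs (by simp [hl, add_assoc]) hrs x hxm hx
    obtain ⟨rs'', h1, h2⟩ := ih (QuotSMulTop x M) n ⟨rs', hl', hrs'⟩ hmem' hdim
    exact ⟨rs'', h1, (LinearEquiv.isRegular_congr 
      (Submodule.quotOfListConsSMulTopEquivQuotSMulTopInner M x _) _).mpr h2⟩


/-- regular local rings are domains and have a regular sequence of full length. -/
lemma CI_reg (d : ℕ) : ∀ (R : Type) [CommRing R] [IsLocalRing R] [IsNoetherianRing R]
    (s : Fin d → R), Ideal.span (Set.range s) = maximalIdeal R →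
    (d : WithBot ℕ∞) ≤ ringKrullDim R →
    IsDomain R ∧ ∃ rs : List R, rs.length = d ∧ (∀ r ∈ rs, r ∈ maximalIdeal R) ∧ 
      IsWeaklyRegular R rs := by
  induction d with
  | zero =>
    intro R _ _ _ s hs _
    have h0 : maximalIdeal R = ⊥ := by rw [← hs]; simp
    exact ⟨(isField_iff_maximalIdeal_eq.mpr h0).isDomain, [], rfl, by simp, IsWeaklyRegular.nil R R⟩
  | succ d ih =>
    intro R _ _ _ s hs hd
    classical
    have hht : (maximalIdeal R) ∉ minimalPrimes R := by
      intro hmem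
      have h1 := Ideal.height_eq_zero_iff.mpr hmem
      rw [← maximalIdeal_height_eq_ringKrullDim, h1] at hd
      have : ((d + 1 : ℕ) : ℕ∞) ≤ 0 := by exact_mod_cast hd
      simp at this
    obtain ⟨x, hxm, hx2, hxp⟩ : ∃ x ∈ maximalIdeal R, x ∉ (maximalIdeal R)^2 ∧
        ∀ p ∈ minimalPrimes R, x ∉ p := by
      by_contra! hcon
      have hfin := minimalPrimes.finite_of_isNoetherianRing R
      have h := (Ideal.subset_union_prime (s := insert ((maximalIdeal R)^2) hfin.toFinset) 
        (f := id) ((maximalIdeal R)^2) ((maximalIdeal R)^2) (by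
          intro i hi h1 _
          simp only [Finset.mem_insert, Set.Finite.mem_toFinset] at hi
          exact (hi.resolve_left h1).1.1) (I := maximalIdeal R)).mp (by
          intro x hx
          simp only [Set.mem_iUnion]
          by_cases h2 : x ∈ (maximalIdeal R)^2
          · exact ⟨(maximalIdeal R)^2, by simp, h2⟩
          · obtain ⟨p, hp, hxp⟩ := hcon x hx h2
            exact ⟨p, by simp [hp], hxp⟩)
      obtain ⟨p, hp, hle⟩ := h
      simp only [Finset.mem_insert, Set.Finite.mem_toFinset] at hp
      rcases hp with rfl | hp
      · have h0 : maximalIdeal R = ⊥ := 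
          Submodule.eq_bot_of_le_smul_of_le_jacobson_bot (maximalIdeal R) (maximalIdeal R)
            (IsNoetherian.noetherian _) (by simpa [pow_two] using hle) (by
              rw [IsLocalRing.jacobson_eq_maximalIdeal _ bot_ne_top])
        apply hht
        have := (isField_iff_maximalIdeal_eq.mpr h0).isDomain
        rw [h0, IsDomain.minimalPrimes_eq_singleton_bot]
        rfl
      · apply hht
        have : p = maximalIdeal R := le_antisymm (le_maximalIdeal hp.1.1.ne_top) hle
        rwa [this] at hp
    have hne : Ideal.span {x} ≠ ⊤ := fun h => by
      have := le_maximalIdeal_of_isPrime (maximalIdeal R)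
      rw [Ideal.span_singleton_eq_top] at h
      exact hxm h
    have : Nontrivial (R ⧸ Ideal.span {x}) := Ideal.Quotient.nontrivial_iff.mpr hne
    have hloc : IsLocalRing (R ⧸ Ideal.span {x}) := 
      IsLocalRing.of_surjective' _ Ideal.Quotient.mk_surjective
    have hmaxeq : (maximalIdeal R).map (Ideal.Quotient.mk (Ideal.span {x})) 
        = maximalIdeal (R ⧸ Ideal.span {x}) := 
      map_maximalIdeal_of_surjective _ Ideal.Quotient.mk_surjective
    -- generators
    obtain ⟨i, hi⟩ : ∃ i : Fin (d+1), maximalIdeal R ≤ Ideal.span {x} ⊔ Ideal.span (Set.range (s ∘ i.succAbove)) := by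
      have hx' := hxm
      rw [← hs, Ideal.mem_span_range_iff_exists_fun] at hx'
      obtain ⟨a, ha⟩ := hx'
      obtain ⟨i, hai⟩ : ∃ i, IsUnit (a i) := by
        by_contra! hcon
        apply hx2
        rw [← ha]
        refine Ideal.sum_mem _ fun i _ => ?_
        rw [pow_two]
        refine Ideal.mul_mem_mul (hcon i) ?_
        rw [← hs]
        exact Ideal.subset_span ⟨i, rfl⟩
      refine ⟨i, ?_⟩
      have hj : ∀ j, s (i.succAbove j) ∈ Ideal.span {x} ⊔ Ideal.span (Set.range (s ∘ i.succAbove)) := 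
        fun j => Ideal.mem_sup_right (Ideal.subset_span ⟨j, rfl⟩)
      have hsi : s i ∈ Ideal.span {x} ⊔ Ideal.span (Set.range (s ∘ i.succAbove)) := by
        rw [← Ideal.unit_mul_mem_iff_mem _ hai]
        rw [Fin.sum_univ_succAbove _ i] at ha
        have : a i * s i = x - ∑ j, a (i.succAbove j) * s (i.succAbove j) := by
          rw [← ha]; ring
        rw [this]
        refine Ideal.sub_mem _ (Ideal.mem_sup_left (Ideal.mem_span_singleton_self x)) ?_
        exact Ideal.sum_mem _ fun j _ => Ideal.mul_mem_left _ _ (hj j)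
      rw [← hs, Ideal.span_le]
      rintro _ ⟨j, rfl⟩
      rcases Fin.eq_self_or_eq_succAbove i j with rfl | ⟨j, rfl⟩
      · exact hsi
      · exact hj j
    have hgen : Ideal.span (Set.range (fun j => Ideal.Quotient.mk (Ideal.span {x}) (s (i.succAbove j)))) 
        = maximalIdeal (R ⧸ Ideal.span {x}) := by
      rw [← hmaxeq]
      apply le_antisymm
      · rw [Ideal.span_le]
        rintro _ ⟨j, rfl⟩
        apply Ideal.mem_map_of_mem
        rw [← hs]
        exact Ideal.subset_span ⟨_, rfl⟩
      · refine (Ideal.map_mono hi).trans ?_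
        rw [Ideal.map_sup, Ideal.map_span, Ideal.map_span]
        simp only [Set.image_singleton]
        rw [Ideal.Quotient.eq_zero_iff_mem.mpr (Ideal.mem_span_singleton_self x)]
        simp only [Ideal.span_singleton_zero, bot_sup_eq]
        rw [← Set.range_comp]
        rfl
    have hdim : (d : WithBot ℕ∞) ≤ ringKrullDim (R ⧸ Ideal.span {x}) := by
      have h1 := Ideal.height_le_ringKrullDim_quotient_add_one hxm
      rw [maximalIdeal_height_eq_ringKrullDim] at h1
      have h2 := hd.trans h1
      push_cast at h2
      exact ENat.WithBot.add_le_add_one_right_iff.mp h2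
    obtain ⟨hdom, rs, hl, hmem, hreg⟩ := ih (R ⧸ Ideal.span {x}) _ hgen hdim
    have hxprime : (Ideal.span {x}).IsPrime := (Ideal.Quotient.isDomain_iff_prime _).mp hdom
    have hD : IsDomain R := by
      obtain ⟨p, hp, hle⟩ := Ideal.exists_minimalPrimes_le (I := (⊥ : Ideal R)) (J := Ideal.span {x}) bot_le
      have hpp := hp.1.1
      have hp0 : p = ⊥ := by
        refine Submodule.eq_bot_of_le_smul_of_le_jacobson_bot (Ideal.span {x}) p
            (IsNoetherian.noetherian _) ?_ (by
              rw [IsLocalRing.jacobson_eq_maximalIdeal _ bot_ne_top]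
              exact le_maximalIdeal hne)
        intro a ha
        obtain ⟨b, rfl⟩ := Ideal.mem_span_singleton.mp (hle ha)
        exact Submodule.smul_mem_smul (Ideal.mem_span_singleton_self x) 
          ((hpp.mem_or_mem ha).resolve_left (hxp p hp))
      rw [hp0] at hpp
      have := (Ideal.Quotient.isDomain_iff_prime _).mpr hpp
      exact (RingEquiv.quotientBot R).symm.toMulEquiv.isDomain _
    refine ⟨hD, ?_⟩
    obtain ⟨rs, rfl⟩ := List.map_surjective_iff.mpr (Ideal.Quotient.mk_surjective (I := Ideal.span {x})) rs
    refine ⟨x :: rs, by simpa using hl, ?_, ?_⟩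
    · intro r hr
      rcases List.mem_cons.mp hr with rfl | hr
      · exact hxm
      · have h1 := hmem _ (List.mem_map_of_mem hr)
        intro hu
        exact h1 (hu.map _)
    · rw [isWeaklyRegular_cons_iff]
      refine ⟨?_, ?_⟩
      · have hx0 : x ≠ 0 := fun h => hx2 (by rw [h]; exact zero_mem _)
        intro a b hab
        exact mul_left_cancel₀ hx0 hab
      · have h1 := (isWeaklyRegular_map_algebraMap_iff (R ⧸ Ideal.span {x}) (R ⧸ Ideal.span {x}) rs).mp hreg
        refine (LinearEquiv.isWeaklyRegular_congr ?_ rs).mp h1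
        exact Submodule.quotEquivOfEq _ _ (by simp [← Submodule.ideal_span_singleton_smul])


/-- Hartshorne-type connectedness lemma. -/
lemma CI_L {B : Type} [CommRing B] [IsLocalRing B] (x y : B)
    (hx : ∀ u, x * u = 0 → u = 0) (hy : ∀ u, x ∣ y * u → x ∣ u)
    (hxm : x ∈ maximalIdeal B) (hym : y ∈ maximalIdeal B)
    (J K : Ideal B) (hJK : J * K = ⊥) (hrad : maximalIdeal B ≤ (J ⊔ K).radical) :
    J = ⊥ ∨ K = ⊥ := by
  obtain ⟨r, hr⟩ := hrad hxm
  obtain ⟨s, hs⟩ := hrad hym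
  have hxr : ∀ r u, x ^ r * u = 0 → u = 0 := by
    intro r
    induction r with
    | zero => simp
    | succ r ih => intro u hu; exact hx _ (ih _ (by rw [← hu]; ring))
  have hys : ∀ s u, x ∣ y ^ s * u → x ∣ u := by
    intro s
    induction s with
    | zero => simp
    | succ r ih => intro u hu; exact hy _ (ih _ (by convert hu using 1; ring))
  have hxys : ∀ r u, x ^ r ∣ y ^ s * u → x ^ r ∣ u := by
    intro r
    induction r with
    | zero => simp
    | succ r ih =>
      intro u hu
      obtain ⟨v, rfl⟩ := ih u ((pow_dvd_pow x (Nat.le_succ r)).trans hu)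
      obtain ⟨w, hw⟩ := hu
      have h1 : y ^ s * v - x * w = 0 := hxr r _ (by linear_combination hw)
      rw [pow_succ]
      exact mul_dvd_mul_left _ (hys s v ⟨w, by linear_combination h1⟩)
  obtain ⟨x1, hx1, x2, hx2, hxx⟩ := Submodule.mem_sup.mp hr
  obtain ⟨y1, hy1, y2, hy2, hyy⟩ := Submodule.mem_sup.mp hs
  have hz : ∀ a ∈ J, ∀ b ∈ K, a * b = 0 := fun a ha b hb => by
    have := Ideal.mul_mem_mul ha hb
    rwa [hJK] at this
  have h12 := hz _ hx1 _ hy2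
  have h21 := hz _ hy1 _ hx2
  have h11 := hz _ hx1 _ hx2
  obtain ⟨e, he⟩ := hxys r x1 ⟨y1, by rw [← hxx, ← hyy]; linear_combination h12 - h21⟩
  have hee : e * (1 - e) = 0 := by
    apply hxr r; apply hxr r
    have : x2 = x ^ r * (1 - e) := by linear_combination hxx - he
    rw [he, this] at h11
    linear_combination h11
  rcases IsLocalRing.isUnit_or_isUnit_one_sub_self e with hu | hu
  · have h1 : 1 - e = 0 := by simpa using (hu.mul_right_eq_zero (b := 1 - e)).mp hee
    right
    rw [eq_bot_iff]
    intro b hb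
    refine hxr r b ?_
    have := hz _ hx1 _ hb
    rw [he] at this
    linear_combination this + x ^ r * b * h1
  · have h1 : e = 0 := by simpa using (hu.mul_left_eq_zero (a := e)).mp hee
    left
    rw [eq_bot_iff]
    intro b hb
    refine hxr r b ?_
    have := hz _ hb _ hx2
    have h2 : x2 = x ^ r := by rw [← hxx, he, h1]; ring
    rw [h2] at this
    linear_combination this


/-- The maximal ideal of a point. -/
noncomputable abbrev CIn {k : Type} [Field k] {n : ℕ} (x : Fin n → k) : Ideal (MvPolynomial (Fin n) k) :=
  RingHom.ker (eval x)

instance CIn_max {k : Type} [Field k] {n : ℕ} (x : Fin n → k) : (CIn x).IsMaximal :=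
  RingHom.ker_isMaximal_of_surjective _ (fun a => ⟨C a, by simp⟩)

lemma CIn_vanishing {k : Type} [Field k] {n : ℕ} (x : Fin n → k) :
    vanishingIdeal k {x} = CIn x := by
  ext p
  rw [mem_vanishingIdeal_singleton_iff, RingHom.mem_ker]
  simp [aeval_eq_eval]

lemma CIn_span {k : Type} [Field k] {n : ℕ} (x : Fin n → k) :
    Ideal.span (Set.range fun j => X j - C (x j)) = CIn x := by
  apply le_antisymm
  · rw [Ideal.span_le]
    rintro _ ⟨j, rfl⟩
    simp [RingHom.mem_ker]
  · have key : ∀ p : MvPolynomial (Fin n) k, 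
        p - C (eval x p) ∈ Ideal.span (Set.range fun j => X j - C (x j)) := by
      intro p
      induction p using MvPolynomial.induction_on with
      | C a => simp
      | add p q hp hq =>
        have := Ideal.add_mem _ hp hq
        simp only [map_add]
        convert this using 1
        ring
      | mul_X p i hp =>
        have h1 : X i - C (x i) ∈ Ideal.span (Set.range fun j => (X j - C (x j) : MvPolynomial (Fin n) k)) := 
          Ideal.subset_span ⟨i, rfl⟩
        have := Ideal.add_mem _ (Ideal.mul_mem_right (X i) _ hp) (Ideal.mul_mem_left _ (C (eval x p)) h1)
        simp only [map_mul, eval_X]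
        convert this using 1
        ring
    intro p hp
    have := key p
    rw [RingHom.mem_ker] at hp
    simpa [hp] using this

lemma CI_taylor {k : Type} [Field k] {n : ℕ} (x : Fin n → k) (p : MvPolynomial (Fin n) k) :
    p - C (eval x p) - ∑ j, C (eval x (pderiv j p)) * (X j - C (x j)) ∈ (CIn x) ^ 2 := by
  classical
  have hX : ∀ i, X i - C (x i) ∈ CIn x := fun i => by simp [RingHom.mem_ker]
  induction p using MvPolynomial.induction_on with
  | C a => simp
  | add p q hp hq =>
    have := Ideal.add_mem _ hp hq
    simp only [map_add, add_mul, Finset.sum_add_distrib]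
    convert this using 1
    ring
  | mul_X p i hp =>
    have h2 : (∑ j, C (eval x (pderiv j p)) * (X j - C (x j))) * (X i - C (x i)) ∈ (CIn x)^2 := by
      rw [pow_two]
      exact Ideal.mul_mem_mul (Ideal.sum_mem _ fun j _ => Ideal.mul_mem_left _ _ (hX j)) (hX i)
    have := Ideal.add_mem _ (Ideal.mul_mem_right (X i) _ hp) h2
    convert this using 1
    have h3 : ∑ j, C (eval x (pderiv j (p * X i))) * (X j - C (x j)) = 
      C (x i) * (∑ j, C (eval x (pderiv j p)) * (X j - C (x j))) + C (eval x p) * (X i - C (x i)) := by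
      have : ∀ j, C (eval x (pderiv j (p * X i))) * (X j - C (x j)) = 
        C (x i) * (C (eval x (pderiv j p)) * (X j - C (x j))) + 
          (if j = i then C (eval x p) * (X i - C (x i)) else 0) := by
        intro j
        rw [pderiv_mul, pderiv_X]
        by_cases h : j = i
        · subst h; simp; ring
        · simp [h, Ne.symm h]; ring
      simp only [this, Finset.sum_add_distrib, ← Finset.mul_sum]
      simp
    rw [h3]
    simp only [map_mul, eval_X]
    ring

lemma CI_ht {k : Type} [Field k] [IsAlgClosed k] {n : ℕ} (x : Fin n → k) :
    (CIn x).height = n := by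
  have hd : ringKrullDim (MvPolynomial (Fin n) k) = n := by
    rw [MvPolynomial.ringKrullDim_of_isNoetherianRing]; simp
  have : FiniteRingKrullDim (MvPolynomial (Fin n) k) := by
    rw [finiteRingKrullDim_iff_ne_bot_and_top, hd]
    refine ⟨?_, ?_⟩
    · exact WithBot.natCast_ne_bot n
    · intro h
      have : ((n : ℕ∞) : WithBot ℕ∞) = ((⊤ : ℕ∞) : WithBot ℕ∞) := h
      exact ENat.natCast_ne_top n (WithBot.coe_injective this)
  obtain ⟨p, hp, hph⟩ := Ideal.exists_isMaximal_height (R := MvPolynomial (Fin n) k)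
  obtain ⟨y, rfl⟩ := isMaximal_iff_eq_vanishingIdeal_singleton.mp hp
  rw [CIn_vanishing, hd] at hph
  have hph' : (CIn y).height = n := by exact_mod_cast hph
  let f : (Fin n → k) → (MvPolynomial (Fin n) k →ₐ[k] MvPolynomial (Fin n) k) := 
    fun a => aeval (fun i => X i + C (a i))
  have hf : ∀ a, (f a).comp (f (-a)) = AlgHom.id k _ := by
    intro a
    ext i : 1
    simp [f]
  let e : MvPolynomial (Fin n) k ≃ₐ[k] MvPolynomial (Fin n) k := 
    AlgEquiv.ofAlgHom (f (x - y)) (f (-(x - y))) (hf _) (by simpa using hf (-(x-y)))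
  have := RingEquiv.height_comap e.toRingEquiv (CIn y)
  rw [← hph', ← this]
  congr 1
  ext p
  rw [Ideal.mem_comap, RingHom.mem_ker, RingHom.mem_ker]
  have h2 : eval x p = eval y (f (x - y) p) := by
    induction p using MvPolynomial.induction_on with
    | C a => simp [f]
    | add p q hp hq => simp [hp, hq]
    | mul_X p i hp => simp [hp]; simp [f]
  rw [h2]
  rfl

/-- local rings of affine space. -/
lemma CI_Ax {k : Type} [Field k] [IsAlgClosed k] {n : ℕ} (x : Fin n → k) :
    ringKrullDim (Localization.AtPrime (CIn x)) = n ∧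
    Ideal.span (Set.range fun j => algebraMap _ (Localization.AtPrime (CIn x)) (X j - C (x j))) = 
      maximalIdeal (Localization.AtPrime (CIn x)) := by
  constructor
  · rw [IsLocalization.AtPrime.ringKrullDim_eq_height (CIn x), CI_ht]; rfl
  · rw [← Localization.AtPrime.map_eq_maximalIdeal]
    have h := congrArg (Ideal.map (algebraMap _ (Localization.AtPrime (CIn x)))) (CIn_span x)
    rw [Ideal.map_span, ← Set.range_comp] at h
    exact h

lemma CI_dimloc {S A : Type} [CommRing S] [CommRing A] [Algebra S A] (M : Submonoid S)
    [IsLocalization M A] (I : Ideal S) :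
    ringKrullDim (A ⧸ I.map (algebraMap S A)) ≤ ringKrullDim (S ⧸ I) := by
  refine Order.krullDim_le_of_strictMono 
    (PrimeSpectrum.comap (algebraMap (S ⧸ I) (A ⧸ I.map (algebraMap S A)))) ?_
  refine Monotone.strictMono_of_injective ?_ 
    (PrimeSpectrum.localization_comap_injective _ (Algebra.algebraMapSubmonoid (S ⧸ I) M))
  intro p q hpq
  exact Ideal.comap_mono hpq

/-- depth two at the origin. -/
lemma CI_depth {k : Type} [Field k] [IsAlgClosed k] {n c D : ℕ} (x : Fin n → k) 
    (F : Fin c → MvPolynomial (Fin n) k) (hF : ∀ i, F i ∈ CIn x) (hD : D + c = n) (h2 : 2 ≤ D)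
    (hdim : ringKrullDim (MvPolynomial (Fin n) k ⧸ Ideal.span (Set.range F)) ≤ D) :
    ∃ a b : Localization.AtPrime (CIn x), a ∈ maximalIdeal _ ∧ b ∈ maximalIdeal _ ∧
      (∀ u, a * u ∈ (Ideal.span (Set.range F)).map (algebraMap _ (Localization.AtPrime (CIn x))) → 
        u ∈ (Ideal.span (Set.range F)).map (algebraMap _ (Localization.AtPrime (CIn x)))) ∧
      (∀ u, b * u ∈ (Ideal.span (Set.range F)).map (algebraMap _ (Localization.AtPrime (CIn x))) ⊔ Ideal.span {a} → 
        u ∈ (Ideal.span (Set.range F)).map (algebraMap _ (Localization.AtPrime (CIn x))) ⊔ Ideal.span {a}) := by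
  set A := Localization.AtPrime (CIn x) with hA
  set I := (Ideal.span (Set.range F)).map (algebraMap _ A) with hI
  have : IsNoetherianRing A := IsLocalization.isNoetherianRing (CIn x).primeCompl A inferInstance
  obtain ⟨hA1, hA2⟩ := CI_Ax x
  obtain ⟨_, rs, hl, hmem, hreg⟩ := CI_reg n A _ hA2 hA1.ge
  let fs : List A := List.ofFn (fun i => algebraMap _ A (F i))
  have hfs : Ideal.ofList fs = I := by
    rw [hI, Ideal.map_span, ← Set.range_comp, Ideal.ofList]
    congr 1
    ext a
    simp [fs]
  have hfs' : Ideal.ofList fs • (⊤ : Submodule A A) = I := by rw [hfs]; simp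
  obtain ⟨rs', hl', hreg'⟩ := CI_CM fs A D ⟨rs, by simp [fs, hl, hD], 
    IsRegular.of_isWeaklyRegular_of_mem_maximalIdeal _ hmem hreg⟩ (by
      intro r hr
      simp only [fs, List.mem_ofFn] at hr
      obtain ⟨i, rfl⟩ := hr
      rw [← Localization.AtPrime.map_eq_maximalIdeal]
      exact Ideal.mem_map_of_mem _ (hF i)) (by
      rw [hfs', Module.supportDim_quotient_eq_ringKrullDim]
      exact (CI_dimloc (CIn x).primeCompl _).trans hdim)
  rw [hfs'] at hreg'
  match rs', hl' with
  | [], h => simp at h; omega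
  | [_], h => simp at h; omega
  | a :: b :: t, _ => 
    have hw := hreg'.toIsWeaklyRegular
    rw [isWeaklyRegular_cons_iff, isWeaklyRegular_cons_iff] at hw
    obtain ⟨h1, h2, _⟩ := hw
    have hmm : ∀ r ∈ a :: b :: t, r ∈ maximalIdeal A := by
      by_contra! hcon
      obtain ⟨r, hr, hrm⟩ := hcon
      apply hreg'.top_ne_smul
      have : Ideal.ofList (a :: b :: t) = ⊤ := 
        Ideal.eq_top_of_isUnit_mem _ (Ideal.subset_span hr) (by simpa using hrm)
      rw [this]; simp
    refine ⟨a, b, hmm a (by simp), hmm b (by simp), ?_, ?_⟩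
    · intro u hu
      have h3 : a • (Submodule.Quotient.mk u : A ⧸ I) = a • 0 := by
        rw [smul_zero, ← Submodule.Quotient.mk_smul, Submodule.Quotient.mk_eq_zero]
        exact hu
      exact (Submodule.Quotient.mk_eq_zero _).mp (h1 h3)
    · have key : ∀ u : A, (Submodule.Quotient.mk (Submodule.Quotient.mk u : A ⧸ I) : QuotSMulTop a (A ⧸ I)) = 0 ↔ 
          u ∈ I ⊔ Ideal.span {a} := by
        intro u
        rw [Submodule.Quotient.mk_eq_zero]
        constructor
        · intro h
          obtain ⟨v, -, hv⟩ := h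
          obtain ⟨v, rfl⟩ := Submodule.Quotient.mk_surjective _ v
          have h4 : u - a * v ∈ I := by
            rw [← Submodule.Quotient.mk_eq_zero, Submodule.Quotient.mk_sub, ← hv, sub_eq_zero]
            rfl
          have := Ideal.add_mem (I ⊔ Ideal.span {a}) (Ideal.mem_sup_left h4)
            (Ideal.mem_sup_right (Ideal.mul_mem_right v _ (Ideal.mem_span_singleton_self a)))
          simpa using this
        · intro h
          obtain ⟨i, hi, w, hw, rfl⟩ := Submodule.mem_sup.mp h
          obtain ⟨v, rfl⟩ := Ideal.mem_span_singleton.mp hw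
          rw [Submodule.Quotient.mk_add, (Submodule.Quotient.mk_eq_zero _).mpr hi, zero_add]
          exact ⟨Submodule.Quotient.mk v, trivial, rfl⟩
      intro u hu
      rw [← key] at hu ⊢
      refine h2 ?_
      simp only [smul_zero]
      exact hu

lemma CI_mapI_le {k : Type} [Field k] {n c : ℕ} (x : Fin n → k) 
    (F : Fin c → MvPolynomial (Fin n) k) (hF : ∀ i, F i ∈ CIn x) :
    (Ideal.span (Set.range F)).map (algebraMap _ (Localization.AtPrime (CIn x))) ≤ 
      maximalIdeal (Localization.AtPrime (CIn x)) := by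
  rw [← Localization.AtPrime.map_eq_maximalIdeal]
  refine Ideal.map_mono ?_
  rw [Ideal.span_le]
  rintro _ ⟨i, rfl⟩
  exact hF i

lemma CI_mem_loc {S : Type} [CommRing S] (P I : Ideal S) [P.IsPrime] (f : S) 
    (h : algebraMap S (Localization.AtPrime P) f ∈ I.map (algebraMap S (Localization.AtPrime P))) :
    ∃ s, s ∉ P ∧ s * f ∈ I := by
  rw [IsLocalization.algebraMap_mem_map_algebraMap_iff P.primeCompl] at h
  obtain ⟨s, hs, hf⟩ := h
  exact ⟨s, hs, hf⟩

lemma CI_L1 {A : Type} [CommRing A] [IsLocalRing A] (a b : A) (I J' K' : Ideal A)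
    (hle : I ≤ maximalIdeal A)
    (ham : a ∈ maximalIdeal A) (hbm : b ∈ maximalIdeal A)
    (ha : ∀ u, a * u ∈ I → u ∈ I) 
    (hb : ∀ u, b * u ∈ I ⊔ Ideal.span {a} → u ∈ I ⊔ Ideal.span {a})
    (hJK' : J' * K' ≤ I) (hr' : maximalIdeal A ≤ (J' ⊔ K').radical) : J' ≤ I ∨ K' ≤ I := by
  have hIne : I ≠ ⊤ := fun h => by
    rw [h, top_le_iff] at hle
    exact (maximalIdeal.isMaximal (A)).ne_top hle
  have : Nontrivial (A ⧸ I) := Ideal.Quotient.nontrivial_iff.mpr hIne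
  have hloc : IsLocalRing (A ⧸ I) := 
      IsLocalRing.of_surjective' _ Ideal.Quotient.mk_surjective
  have hmaxeq : (maximalIdeal (A)).map (Ideal.Quotient.mk I) 
        = maximalIdeal (A ⧸ I) := 
      map_maximalIdeal_of_surjective _ Ideal.Quotient.mk_surjective
  have fin : ∀ L : Ideal (A), L.map (Ideal.Quotient.mk I) = ⊥ → L ≤ I := by
    intro L hL f hf
    rw [← Ideal.Quotient.eq_zero_iff_mem]
    have := Ideal.mem_map_of_mem (Ideal.Quotient.mk I) hf
    rwa [hL] at this
  have := CI_L (Ideal.Quotient.mk I a) (Ideal.Quotient.mk I b) (by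
      intro u hu
      obtain ⟨u, rfl⟩ := Ideal.Quotient.mk_surjective u
      rw [← map_mul, Ideal.Quotient.eq_zero_iff_mem] at hu
      exact Ideal.Quotient.eq_zero_iff_mem.mpr (ha u hu)) (by
      intro u hu
      obtain ⟨u, rfl⟩ := Ideal.Quotient.mk_surjective u
      have key : ∀ u, Ideal.Quotient.mk I a ∣ Ideal.Quotient.mk I u ↔ u ∈ I ⊔ Ideal.span {a} := by
        intro u
        rw [Submodule.mem_sup]
        constructor
        · rintro ⟨v, hv⟩
          obtain ⟨v, rfl⟩ := Ideal.Quotient.mk_surjective v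
          rw [← map_mul, Ideal.Quotient.eq] at hv
          exact ⟨_, hv, a * v, Ideal.mem_span_singleton.mpr ⟨v, rfl⟩, by ring⟩
        · rintro ⟨i, hi, w, hw, rfl⟩
          obtain ⟨v, rfl⟩ := Ideal.mem_span_singleton.mp hw
          rw [map_add, Ideal.Quotient.eq_zero_iff_mem.mpr hi, zero_add, map_mul]
          exact dvd_mul_right _ _
      rw [← map_mul, key] at hu
      exact (key u).mpr (hb u hu))
    (by rw [← hmaxeq]; exact Ideal.mem_map_of_mem _ ham)
    (by rw [← hmaxeq]; exact Ideal.mem_map_of_mem _ hbm)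
    (J'.map (Ideal.Quotient.mk I)) (K'.map (Ideal.Quotient.mk I)) (by
      rw [← Ideal.map_mul, eq_bot_iff]
      refine (Ideal.map_mono hJK').trans ?_
      rw [Ideal.map_quotient_self]) (by
      rw [← hmaxeq, ← Ideal.map_sup]
      exact (Ideal.map_mono hr').trans (Ideal.map_radical_le _))
  exact this.imp (fin _) (fin _)

lemma CI_L2 {k : Type} [Field k] [IsAlgClosed k] {n c D : ℕ} (x : Fin n → k) 
    (F : Fin c → MvPolynomial (Fin n) k) (hF : ∀ i, F i ∈ CIn x) (hD : D + c = n) (h2 : 2 ≤ D)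
    (hdim : ringKrullDim (MvPolynomial (Fin n) k ⧸ Ideal.span (Set.range F)) ≤ D)
    (J K : Ideal (MvPolynomial (Fin n) k)) (hJK : J * K ≤ Ideal.span (Set.range F))
    (hr : CIn x ≤ (J ⊔ K).radical) : 
    (∀ f ∈ J, ∃ s, s ∉ CIn x ∧ s * f ∈ Ideal.span (Set.range F)) ∨ 
    (∀ f ∈ K, ∃ s, s ∉ CIn x ∧ s * f ∈ Ideal.span (Set.range F)) := by
  obtain ⟨a, b, ham, hbm, ha, hb⟩ := CI_depth x F hF hD h2 hdim
  have hle := CI_mapI_le x F hF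
  have hmem := CI_mem_loc (CIn x) (Ideal.span (Set.range F))
  have hmax : (CIn x).map (algebraMap _ (Localization.AtPrime (CIn x))) = 
    maximalIdeal (Localization.AtPrime (CIn x)) := Localization.AtPrime.map_eq_maximalIdeal
  have hJK' := Ideal.map_mono (f := algebraMap _ (Localization.AtPrime (CIn x))) hJK
  have hr' := (Ideal.map_mono (f := algebraMap _ (Localization.AtPrime (CIn x))) hr).trans 
    (Ideal.map_radical_le _)
  rw [Ideal.map_mul] at hJK'
  rw [hmax, Ideal.map_sup] at hr'
  rcases CI_L1 a b _ _ _ hle ham hbm ha hb hJK' hr' with h | h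
  · exact Or.inl fun f hf => hmem f (h (Ideal.mem_map_of_mem _ hf))
  · exact Or.inr fun f hf => hmem f (h (Ideal.mem_map_of_mem _ hf))

lemma CI_nonempty {k : Type} [Field k] [IsAlgClosed k] {n c D : ℕ} (x : Fin n → k) 
    (F : Fin c → MvPolynomial (Fin n) k) (hF : ∀ i, F i ∈ CIn x) (hD : D + c = n) (h2 : 2 ≤ D)
    (hdim : ringKrullDim (MvPolynomial (Fin n) k ⧸ Ideal.span (Set.range F)) ≤ D) :
    ¬ (CIn x ≤ (Ideal.span (Set.range F)).radical) := by
  intro hr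
  obtain ⟨a, b, ham, hbm, ha, hb⟩ := CI_depth x F hF hD h2 hdim
  have hle := CI_mapI_le x F hF
  have hmax : (CIn x).map (algebraMap _ (Localization.AtPrime (CIn x))) = 
    maximalIdeal (Localization.AtPrime (CIn x)) := Localization.AtPrime.map_eq_maximalIdeal
  have hr' := (Ideal.map_mono (f := algebraMap _ (Localization.AtPrime (CIn x))) hr).trans 
    (Ideal.map_radical_le _)
  rw [hmax] at hr'
  obtain ⟨r, hr⟩ := hr' ham
  have : ∀ r : ℕ, a ^ r ∈ (Ideal.span (Set.range F)).map (algebraMap _ (Localization.AtPrime (CIn x))) → False := by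
    intro r
    induction r with
    | zero => 
      intro h
      rw [pow_zero] at h
      exact (hle h) isUnit_one
    | succ r ih =>
      intro h
      rw [pow_succ'] at h
      exact ih (ha _ h)
  exact this r hr

lemma CI_decomp0 {k : Type} [Field k] {n : ℕ} (f : MvPolynomial (Fin n) k) :
    ((DirectSum.decompose (homogeneousSubmodule (Fin n) k) f 0 : homogeneousSubmodule (Fin n) k 0) : 
      MvPolynomial (Fin n) k) = C (eval 0 f) := by
  have h := decomposition.decompose'_apply f 0
  rw [homogeneousComponent_zero] at h
  rw [eval_zero]
  exact h

lemma CI_hom_le {k : Type} [Field k] {n : ℕ} (P : Ideal (MvPolynomial (Fin n) k)) 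
    (hP : P.IsHomogeneous (homogeneousSubmodule (Fin n) k)) (hne : P ≠ ⊤) : P ≤ CIn 0 := by
  intro f hf
  have h := hP 0 hf
  rw [CI_decomp0] at h
  by_contra hcon
  rw [RingHom.mem_ker] at hcon
  exact hne (Ideal.eq_top_of_isUnit_mem _ h ((isUnit_iff_ne_zero.mpr hcon).map C))

lemma CI_cancel {k : Type} [Field k] {n : ℕ} (I : Ideal (MvPolynomial (Fin n) k)) 
    (hI : I.IsHomogeneous (homogeneousSubmodule (Fin n) k)) (s f : MvPolynomial (Fin n) k)
    (hf : SetLike.IsHomogeneousElem (homogeneousSubmodule (Fin n) k) f) (hs : s ∉ CIn 0) 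
    (h : s * f ∈ I) : f ∈ I := by
  obtain ⟨j, hj⟩ := hf
  have h1 := hI (0 + j) h
  rw [DirectSum.coe_decompose_mul_add_of_right_mem _ hj, CI_decomp0] at h1
  rw [RingHom.mem_ker] at hs
  exact (Ideal.unit_mul_mem_iff_mem _ ((isUnit_iff_ne_zero.mpr hs).map C)).mp h1

lemma CI_irr {k : Type} [Field k] {n : ℕ} :
    CIn 0 = (HomogeneousIdeal.irrelevant (homogeneousSubmodule (Fin n) k)).toIdeal := by
  ext f
  rw [RingHom.mem_ker]
  have h : f ∈ (HomogeneousIdeal.irrelevant (homogeneousSubmodule (Fin n) k)).toIdeal ↔ _ := 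
    HomogeneousIdeal.mem_irrelevant_iff (homogeneousSubmodule (Fin n) k) f
  rw [h, GradedRing.proj_apply, CI_decomp0]
  simp

lemma CI_rad {k : Type} [Field k] {n : ℕ} (Q G : Ideal (MvPolynomial (Fin n) k)) 
    (hQ : Q.IsHomogeneous (homogeneousSubmodule (Fin n) k)) (hG : G ≤ CIn 0)
    (h : ∀ P : ProjectiveSpectrum (homogeneousSubmodule (Fin n) k), 
      Q ≤ P.asHomogeneousIdeal.toIdeal → G ≤ P.asHomogeneousIdeal.toIdeal) :
    G ≤ Q.radical := by
  rw [hQ.radical_eq]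
  refine le_sInf ?_
  rintro P ⟨hP, hQP, hprime⟩
  by_cases hirr : HomogeneousIdeal.irrelevant (homogeneousSubmodule (Fin n) k) ≤ ⟨P, hP⟩
  · refine hG.trans ?_
    rw [CI_irr]
    exact hirr
  · exact h ⟨⟨P, hP⟩, hprime, hirr⟩ hQP

lemma CI_P_le {k : Type} [Field k] {n : ℕ}
    (P : ProjectiveSpectrum (homogeneousSubmodule (Fin n) k)) : P.asHomogeneousIdeal.toIdeal ≤ CIn 0 :=
  CI_hom_le _ P.asHomogeneousIdeal.isHomogeneous P.isPrime.ne_top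

lemma CI_connected {k : Type} [Field k] [IsAlgClosed k] {n c D : ℕ}
    (F : Fin c → MvPolynomial (Fin n) k) (hF : ∀ i, F i ∈ CIn 0) (hD : D + c = n) (h2 : 2 ≤ D)
    (hdim : ringKrullDim (MvPolynomial (Fin n) k ⧸ Ideal.span (Set.range F)) ≤ D)
    (hhom : (Ideal.span (Set.range F)).IsHomogeneous (homogeneousSubmodule (Fin n) k)) :
    IsConnected (ProjectiveSpectrum.zeroLocus (homogeneousSubmodule (Fin n) k) (Set.range F)) := by
  have hmemZ : ∀ P, P ∈ ProjectiveSpectrum.zeroLocus (homogeneousSubmodule (Fin n) k) (Set.range F) ↔ 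
      Ideal.span (Set.range F) ≤ P.asHomogeneousIdeal.toIdeal := by
    intro P
    rw [ProjectiveSpectrum.mem_zeroLocus, Ideal.span_le]
    rfl
  have hZc := ProjectiveSpectrum.isClosed_zeroLocus (homogeneousSubmodule (Fin n) k) (Set.range F)
  set Z := ProjectiveSpectrum.zeroLocus (homogeneousSubmodule (Fin n) k) (Set.range F) with hZ
  refine ⟨?_, ?_⟩
  · by_contra hcon
    rw [Set.not_nonempty_iff_eq_empty] at hcon
    refine CI_nonempty 0 F hF hD h2 hdim (CI_rad _ _ hhom le_rfl ?_)
    intro P hP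
    rw [← hmemZ, hcon] at hP
    exact hP.elim
  · rw [isPreconnected_closed_iff]
    intro t t' ht ht' hcov hne hne'
    by_contra hemp
    rw [Set.not_nonempty_iff_eq_empty] at hemp
    let J := ProjectiveSpectrum.vanishingIdeal (Z ∩ t)
    let K := ProjectiveSpectrum.vanishingIdeal (Z ∩ t')
    have hzero : ∀ (T : Set (ProjectiveSpectrum (homogeneousSubmodule (Fin n) k))), IsClosed T → ∀ P : ProjectiveSpectrum (homogeneousSubmodule (Fin n) k),
        (ProjectiveSpectrum.vanishingIdeal T).toIdeal ≤ P.asHomogeneousIdeal.toIdeal → P ∈ T := by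
      intro T hT P hP
      rw [← hT.closure_eq, ← ProjectiveSpectrum.zeroLocus_vanishingIdeal_eq_closure, 
        ProjectiveSpectrum.mem_zeroLocus]
      exact hP
    have hvan : ∀ (T : Set (ProjectiveSpectrum (homogeneousSubmodule (Fin n) k))), ∀ P ∈ T, 
        (ProjectiveSpectrum.vanishingIdeal T).toIdeal ≤ P.asHomogeneousIdeal.toIdeal := by
      intro T P hP f hf
      exact (ProjectiveSpectrum.mem_vanishingIdeal T f).mp hf P hP
    have hJm : J.toIdeal ≤ CIn 0 := by
      obtain ⟨P, hP⟩ := hne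
      exact (hvan _ P hP).trans (CI_P_le P)
    have hJK : J.toIdeal * K.toIdeal ≤ (Ideal.span (Set.range F)).radical := by
      refine CI_rad _ _ hhom (Ideal.mul_le_left.trans hJm) ?_
      intro P hP
      rw [← hmemZ] at hP
      rcases hcov hP with h | h
      · exact Ideal.mul_le_left.trans (hvan _ P ⟨hP, h⟩)
      · exact Ideal.mul_le_right.trans (hvan _ P ⟨hP, h⟩)
    have hm : CIn 0 ≤ (J.toIdeal ⊔ K.toIdeal).radical := by
      refine CI_rad _ _ (J.isHomogeneous.sup K.isHomogeneous) le_rfl ?_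
      intro P hP
      have h1 := hzero _ (hZc.inter ht) P (le_sup_left.trans hP)
      have h2 := hzero _ (hZc.inter ht') P (le_sup_right.trans hP)
      have : P ∈ Z ∩ (t ∩ t') := ⟨h1.1, h1.2, h2.2⟩
      rw [hemp] at this
      exact this.elim
    obtain ⟨r, hr⟩ := Ideal.exists_pow_le_of_le_radical_of_fg hJK (IsNoetherian.noetherian _)
    rw [mul_pow] at hr
    have hm' : CIn 0 ≤ (J.toIdeal ^ r ⊔ K.toIdeal ^ r).radical := by
      refine hm.trans ?_
      rw [Ideal.radical_le_radical_iff]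
      refine sup_le ?_ ?_
      · exact fun f hf => ⟨r, Ideal.mem_sup_left (Ideal.pow_mem_pow hf r)⟩
      · exact fun f hf => ⟨r, Ideal.mem_sup_right (Ideal.pow_mem_pow hf r)⟩
    have fin : ∀ (T T' : Set (ProjectiveSpectrum (homogeneousSubmodule (Fin n) k))), IsClosed T → 
        Z ∩ (T ∩ T') = ∅ → (Z ∩ T').Nonempty → 
        (∀ f ∈ (ProjectiveSpectrum.vanishingIdeal (Z ∩ T)).toIdeal ^ r, 
          ∃ s, s ∉ CIn 0 ∧ s * f ∈ Ideal.span (Set.range F)) → False := by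
      intro T T' hT hTT hne hs
      obtain ⟨P, hPZ, hPT⟩ := hne
      have h1 : (ProjectiveSpectrum.vanishingIdeal (Z ∩ T)).toIdeal ≤ P.asHomogeneousIdeal.toIdeal := by
        have hpp := P.isPrime
        intro f hf
        obtain ⟨s, hs1, hs2⟩ := hs (f ^ r) (Ideal.pow_mem_pow hf r)
        have h3 := (hmemZ P).mp hPZ hs2
        exact hpp.mem_of_pow_mem r ((hpp.mem_or_mem h3).resolve_left (fun h => hs1 (CI_P_le P h)))
      have h2 := hzero _ (hZc.inter hT) P h1
      have : P ∈ Z ∩ (T ∩ T') := ⟨hPZ, h2.2, hPT⟩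
      rw [hTT] at this
      exact this.elim
    rcases CI_L2 0 F hF hD h2 hdim _ _ hr hm' with h | h
    · exact fin t t' ht hemp hne' h
    · exact fin t' t ht' (by rwa [Set.inter_comm t' t]) hne h

lemma CI_regquot {A : Type} [CommRing A] [IsLocalRing A] [IsNoetherianRing A] {c D : ℕ}
    (f : Fin c → A) (g : Fin D → A) (hf : ∀ i, f i ∈ maximalIdeal A) (hg : ∀ i, g i ∈ maximalIdeal A)
    (hm : maximalIdeal A ≤ Ideal.span (Set.range f) ⊔ Ideal.span (Set.range g) ⊔ (maximalIdeal A) ^ 2)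
    (hdim : ((D + c : ℕ) : WithBot ℕ∞) ≤ ringKrullDim A) : (Ideal.span (Set.range f)).IsPrime := by
  classical
  have hle : Ideal.span (Set.range f) ≤ maximalIdeal A := by
    rw [Ideal.span_le]; rintro _ ⟨i, rfl⟩; exact hf i
  have hD : (D : WithBot ℕ∞) ≤ ringKrullDim (A ⧸ Ideal.span (Set.range f)) := by
    have h1 := ringKrullDim_le_ringKrullDim_quotient_add_card (Finset.univ.image f) (by
      rw [IsLocalRing.ringJacobson_eq_maximalIdeal]
      intro a ha
      simp only [Finset.coe_image, Finset.coe_univ, Set.image_univ] at ha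
      obtain ⟨i, rfl⟩ := ha
      exact hf i)
    have h2 : (Finset.univ.image f).card ≤ c := Finset.card_image_le.trans (by simp)
    have h3 : ((Finset.univ.image f).card : WithBot ℕ∞) ≤ (c : WithBot ℕ∞) := by exact_mod_cast h2
    have h5 : ((Finset.univ.image f : Finset A) : Set A) = Set.range f := by simp
    rw [h5] at h1
    have h4 := hdim.trans (h1.trans (add_le_add_right h3 _))
    push_cast at h4
    exact ENat.WithBot.add_le_add_natCast_right_iff.mp h4
  generalize hI : Ideal.span (Set.range f) = I at *
  have hIne : I ≠ ⊤ := fun h => by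
    rw [h, top_le_iff] at hle
    exact (maximalIdeal.isMaximal A).ne_top hle
  have : Nontrivial (A ⧸ I) := Ideal.Quotient.nontrivial_iff.mpr hIne
  have hloc : IsLocalRing (A ⧸ I) := 
      IsLocalRing.of_surjective' _ Ideal.Quotient.mk_surjective
  have hmaxeq : (maximalIdeal A).map (Ideal.Quotient.mk I) = maximalIdeal (A ⧸ I) := 
      map_maximalIdeal_of_surjective _ Ideal.Quotient.mk_surjective
  have hspan : Ideal.span (Set.range (Ideal.Quotient.mk I ∘ g)) = maximalIdeal (A ⧸ I) := by
    apply le_antisymm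
    · rw [Ideal.span_le, ← hmaxeq]
      rintro _ ⟨i, rfl⟩
      exact Ideal.mem_map_of_mem _ (hg i)
    · refine Submodule.le_of_le_smul_of_le_jacobson_bot (I := maximalIdeal (A ⧸ I)) 
        (IsNoetherian.noetherian _) (by rw [IsLocalRing.jacobson_eq_maximalIdeal _ bot_ne_top]) ?_
      have h := Ideal.map_mono (f := Ideal.Quotient.mk I) hm
      rw [Ideal.map_sup, Ideal.map_sup, Ideal.map_quotient_self, bot_sup_eq, Ideal.map_pow, hmaxeq,
        Ideal.map_span, ← Set.range_comp, pow_two] at h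
      exact h
  exact (Ideal.Quotient.isDomain_iff_prime _).mp (CI_reg D (A ⧸ I) _ hspan hD).1

lemma CI_smooth {k : Type} [Field k] [IsAlgClosed k] {n c D : ℕ} (x : Fin n → k)
    (F : Fin c → MvPolynomial (Fin n) k) (hF : ∀ i, F i ∈ CIn x) (hD : D + c = n) 
    (hrank : Matrix.rank (Matrix.of fun (i : Fin c) (j : Fin n) =>
      MvPolynomial.eval x (MvPolynomial.pderiv j (F i))) = c) :
    ((Ideal.span (Set.range F)).map (algebraMap _ (Localization.AtPrime (CIn x)))).IsPrime := by
  classical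
  rw [Matrix.rank_eq_finrank_span_row] at hrank
  generalize hW : Submodule.span k (Set.range (Matrix.of fun (i : Fin c) (j : Fin n) =>
      MvPolynomial.eval x (MvPolynomial.pderiv j (F i))).row) = W at hrank
  obtain ⟨W', hW'⟩ := W.exists_isCompl
  have hfr := Submodule.finrank_add_eq_of_isCompl hW'
  have hfr' : finrank k W' = D := by
    rw [hrank] at hfr; simp at hfr; omega
  let b := finBasisOfFinrankEq k W' hfr'
  let ℓ := Fintype.linearCombination k (fun j : Fin n => (X j - C (x j) : MvPolynomial (Fin n) k))
  have hℓ : ∀ v, ℓ v = ∑ j, C (v j) * (X j - C (x j)) := fun v => by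
    simp [ℓ, Fintype.linearCombination_apply, smul_eq_C_mul]
  have hX : ∀ i, X i - C (x i) ∈ CIn x := fun i => by simp [RingHom.mem_ker]
  have hℓm : ∀ v, ℓ v ∈ CIn x := fun v => by
    rw [hℓ]
    exact Ideal.sum_mem _ fun j _ => Ideal.mul_mem_left _ _ (hX j)
  let G : Fin D → MvPolynomial (Fin n) k := fun t => ℓ (b t)
  have hkey : CIn x ≤ Ideal.span (Set.range F) ⊔ Ideal.span (Set.range G) ⊔ (CIn x)^2 := by
    set Q := Ideal.span (Set.range F) ⊔ Ideal.span (Set.range G) ⊔ (CIn x)^2 with hQ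
    let V : Submodule k (Fin n → k) := (Q.restrictScalars k).comap ℓ
    have hV : ∀ v, v ∈ V ↔ ℓ v ∈ Q := fun v => Iff.rfl
    have h1 : W ≤ V := by
      rw [← hW, Submodule.span_le]
      rintro _ ⟨i, rfl⟩
      have ht := CI_taylor x (F i)
      have h0 : eval x (F i) = 0 := hF i
      rw [h0, map_zero, sub_zero] at ht
      change ℓ _ ∈ Q
      rw [hℓ]
      have h3 : F i ∈ Q := Ideal.mem_sup_left (Ideal.mem_sup_left (Ideal.subset_span ⟨i, rfl⟩))
      have h4 := Ideal.sub_mem Q h3 (Ideal.mem_sup_right ht)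
      rw [sub_sub_cancel] at h4
      exact h4
    have h2 : W' ≤ V := by
      intro w hw
      have hb := b.sum_repr ⟨w, hw⟩
      have hb' : w = ∑ t, b.repr ⟨w, hw⟩ t • (b t : Fin n → k) := by
        have := congrArg Subtype.val hb
        rw [Submodule.coe_sum] at this
        exact this.symm
      rw [hb']
      refine Submodule.sum_mem _ fun t _ => Submodule.smul_mem _ _ ?_
      rw [hV]
      exact Ideal.mem_sup_left (Ideal.mem_sup_right (Ideal.subset_span ⟨t, rfl⟩))
    have h3 : V = ⊤ := by
      rw [eq_top_iff, ← hW'.sup_eq_top]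
      exact sup_le h1 h2
    conv_lhs => rw [← CIn_span x]
    rw [Ideal.span_le]
    rintro _ ⟨j, rfl⟩
    have h4 : (Pi.single j 1 : Fin n → k) ∈ V := by rw [h3]; trivial
    rw [hV] at h4
    simpa [ℓ] using h4
  have hmax : (CIn x).map (algebraMap _ (Localization.AtPrime (CIn x))) = 
    maximalIdeal (Localization.AtPrime (CIn x)) := Localization.AtPrime.map_eq_maximalIdeal
  have : IsNoetherianRing (Localization.AtPrime (CIn x)) := 
    IsLocalization.isNoetherianRing (CIn x).primeCompl _ inferInstance
  have hk := Ideal.map_mono (f := algebraMap _ (Localization.AtPrime (CIn x))) hkey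
  rw [Ideal.map_sup, Ideal.map_sup, Ideal.map_pow, hmax, Ideal.map_span, Ideal.map_span, 
    ← Set.range_comp, ← Set.range_comp] at hk
  rw [Ideal.map_span, ← Set.range_comp]
  refine CI_regquot _ _ ?_ ?_ hk ?_
  · intro i; rw [← hmax]; exact Ideal.mem_map_of_mem _ (hF i)
  · intro i; rw [← hmax]; exact Ideal.mem_map_of_mem _ (hℓm _)
  · rw [hD]; exact (CI_Ax x).1.ge

lemma CI_prime {k : Type} [Field k] [IsAlgClosed k] {n c D : ℕ}
    (F : Fin c → MvPolynomial (Fin n) k) (hF : ∀ i, F i ∈ CIn 0) (hD : D + c = n) (h2 : 2 ≤ D)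
    (hdim : ringKrullDim (MvPolynomial (Fin n) k ⧸ Ideal.span (Set.range F)) ≤ D)
    (hhom : (Ideal.span (Set.range F)).IsHomogeneous (homogeneousSubmodule (Fin n) k))
    (hsm : ∀ x : Fin n → k, x ≠ 0 → (∀ i, eval x (F i) = 0) →
      ((Ideal.span (Set.range F)).map (algebraMap _ (Localization.AtPrime (CIn x)))).IsPrime) :
    (Ideal.span (Set.range F)).IsPrime := by
  classical
  have hL2 := CI_L2 0 F hF hD h2 hdim
  have hIle : Ideal.span (Set.range F) ≤ CIn 0 := by
    rw [Ideal.span_le]; rintro _ ⟨i, rfl⟩; exact hF i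
  have hFI : ∀ i, F i ∈ Ideal.span (Set.range F) := fun i => Ideal.subset_span ⟨i, rfl⟩
  generalize hI : Ideal.span (Set.range F) = I at *
  refine hhom.isPrime_of_homogeneous_mem_or_mem ?_ ?_
  · rintro rfl
    rw [top_le_iff] at hIle
    exact (CIn_max (k := k) (n := n) 0).ne_top hIle
  intro a b ha hb hab
  let K : Ideal (MvPolynomial (Fin n) k) := Submodule.comap (LinearMap.mulLeft _ a) I
  have hK : ∀ κ, κ ∈ K ↔ a * κ ∈ I := fun κ => Iff.rfl
  let J : Ideal (MvPolynomial (Fin n) k) := ⨅ κ ∈ K, Submodule.comap (LinearMap.mulLeft _ κ) I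
  have hJ : ∀ j, j ∈ J ↔ ∀ κ ∈ K, κ * j ∈ I := fun j => by
    simp [J, Submodule.mem_iInf]
  have hr : CIn 0 ≤ (J ⊔ K).radical := by
    rw [← vanishingIdeal_zeroLocus_eq_radical (K := k)]
    intro f hf
    rw [mem_vanishingIdeal_iff]
    intro x hx
    rw [mem_zeroLocus_iff] at hx
    by_cases hx0 : x = 0
    · subst hx0
      simpa [aeval_eq_eval] using hf
    exfalso
    have hle : J ⊔ K ≤ CIn x := by
      intro p hp
      have := hx p hp
      simpa [aeval_eq_eval, RingHom.mem_ker] using this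
    have hpr := hsm x hx0 (fun i => hle (Ideal.mem_sup_right ((hK _).mpr (Ideal.mul_mem_left _ _ (hFI i)))))
    by_cases ha' : algebraMap _ (Localization.AtPrime (CIn x)) a ∈ I.map (algebraMap _ (Localization.AtPrime (CIn x)))
    · obtain ⟨s, hs, hsa⟩ := CI_mem_loc _ _ _ ha'
      exact hs (hle (Ideal.mem_sup_right ((hK s).mpr (by rwa [mul_comm]))))
    · have h1 : ∀ κ ∈ K, ∃ s, s ∉ CIn x ∧ s * κ ∈ I := by
        intro κ hκ
        refine CI_mem_loc _ _ _ ?_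
        have h3 := Ideal.mem_map_of_mem (algebraMap _ (Localization.AtPrime (CIn x))) ((hK κ).mp hκ)
        rw [map_mul] at h3
        exact (hpr.mem_or_mem h3).resolve_left ha'
      obtain ⟨T, hT⟩ : K.FG := IsNoetherian.noetherian _
      have h4 : ∀ T' : Finset (MvPolynomial (Fin n) k), (∀ κ ∈ T', κ ∈ K) →
          ∃ s, s ∉ CIn x ∧ ∀ κ ∈ T', κ * s ∈ I := by
        intro T'
        induction T' using Finset.induction_on with
        | empty => 
          intro _
          exact ⟨1, fun h => (CIn_max x).ne_top ((Ideal.eq_top_iff_one _).mpr h), by simp⟩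
        | insert κ T' _ ih =>
          intro hsub
          rw [Finset.forall_mem_insert] at hsub
          obtain ⟨s, hs, hs2⟩ := ih hsub.2
          obtain ⟨s', hs', hs2'⟩ := h1 κ hsub.1
          refine ⟨s * s', fun h => (((CIn_max x).isPrime.mem_or_mem h).elim hs hs'), ?_⟩
          intro κ' hκ'
          rcases Finset.mem_insert.mp hκ' with rfl | h
          · have := Ideal.mul_mem_left I s hs2'
            convert this using 1
            ring
          · have := Ideal.mul_mem_left I s' (hs2 κ' h)
            convert this using 1
            ring
      obtain ⟨s, hs, hs2⟩ := h4 T (fun κ hκ => by rw [← hT]; exact Submodule.subset_span hκ)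
      apply hs
      apply hle
      refine Ideal.mem_sup_left ((hJ s).mpr ?_)
      have h5 : K ≤ Submodule.comap (LinearMap.mulLeft _ s) I := by
        rw [← hT, Submodule.span_le]
        intro κ hκ
        have := hs2 κ hκ
        change s * κ ∈ I
        rwa [mul_comm]
      intro κ hκ
      rw [mul_comm]
      exact h5 hκ
  rcases hL2 J K (by
      rw [Ideal.mul_le]
      intro j hj κ hκ
      rw [mul_comm]
      exact (hJ j).mp hj κ hκ) hr with h | h
  · left
    obtain ⟨s, hs, hs2⟩ := h a ((hJ a).mpr fun κ hκ => by rw [mul_comm]; exact (hK κ).mp hκ)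
    exact CI_cancel I hhom s a ha hs hs2
  · right
    obtain ⟨s, hs, hs2⟩ := h b ((hK b).mpr hab)
    exact CI_cancel I hhom s b hb hs hs2

lemma CI_irred {k : Type} [Field k] {n c : ℕ}
    (F : Fin c → MvPolynomial (Fin n) k) 
    (hhom : (Ideal.span (Set.range F)).IsHomogeneous (homogeneousSubmodule (Fin n) k))
    (hne : (ProjectiveSpectrum.zeroLocus (homogeneousSubmodule (Fin n) k) (Set.range F)).Nonempty)
    (hp : (Ideal.span (Set.range F)).IsPrime) :
    IsIrreducible (ProjectiveSpectrum.zeroLocus (homogeneousSubmodule (Fin n) k) (Set.range F)) := by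
  obtain ⟨P, hP⟩ := hne
  rw [← ProjectiveSpectrum.zeroLocus_span, ProjectiveSpectrum.mem_zeroLocus] at hP
  let Q : ProjectiveSpectrum (homogeneousSubmodule (Fin n) k) := 
    ⟨⟨Ideal.span (Set.range F), hhom⟩, hp, fun h => P.not_irrelevant_le (fun f hf => hP (h hf))⟩
  have : ProjectiveSpectrum.zeroLocus (homogeneousSubmodule (Fin n) k) (Set.range F) = closure {Q} := by
    rw [← ProjectiveSpectrum.zeroLocus_vanishingIdeal_eq_closure, 
      ProjectiveSpectrum.vanishingIdeal_singleton, ← ProjectiveSpectrum.zeroLocus_span]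
    rfl
  rw [this]
  exact isIrreducible_singleton.closure


end helpers

theorem complete_intersection_connected_and_integral
    (k : Type) [Field k] [IsAlgClosed k]
    (N c : ℕ) (hN : 2 ≤ N) (hc : c ≤ N - 1) (hn : 1 ≤ N - c)
    (d : Fin c → ℕ) (hd : ∀ i, 2 ≤ d i) (hmono : Monotone d)
    (F : Fin c → MvPolynomial (Fin (N + 1)) k)
    (hFhom : ∀ i, (F i).IsHomogeneous (d i))
    (hcodim : ringKrullDim (MvPolynomial (Fin (N + 1)) k ⧸ Ideal.span (Set.range F)) =
      ((N + 1 - c : ℕ) : WithBot ℕ∞)) :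
    -- `Z` is connected
    IsConnected (ProjectiveSpectrum.zeroLocus
      (homogeneousSubmodule (Fin (N + 1)) k) (Set.range F)) ∧
    -- if `Z` is smooth, `Z` is integral
    (JacobianSmooth F →
      IsIrreducible (ProjectiveSpectrum.zeroLocus
        (homogeneousSubmodule (Fin (N + 1)) k) (Set.range F)) ∧
      (Ideal.span (Set.range F)).IsPrime) := by
  have hD : (N + 1 - c) + c = N + 1 := by omega
  have h2 : 2 ≤ N + 1 - c := by omega
  have hF : ∀ i, F i ∈ CIn 0 := by
    intro i
    rw [RingHom.mem_ker, eval_zero, constantCoeff_eq]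
    by_contra h
    have h1 := hFhom i h
    simp at h1
    have := hd i
    omega
  have hhom : (Ideal.span (Set.range F)).IsHomogeneous (homogeneousSubmodule (Fin (N + 1)) k) := by
    refine Ideal.homogeneous_span _ _ ?_
    rintro _ ⟨i, rfl⟩
    exact ⟨d i, hFhom i⟩
  have hconn := CI_connected F hF hD h2 hcodim.le hhom
  refine ⟨hconn, fun hJ => ?_⟩
  have hp := CI_prime F hF hD h2 hcodim.le hhom
    (fun x hx hx0 => CI_smooth x F hx0 hD (hJ x hx hx0))
  exact ⟨CI_irred F hhom hconn.1 hp, hp⟩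
end

section
/- Let k be an algebraically closed field and Z ⊂ P^N_k a smooth complete intersection with defining equations F_1, ..., F_c. If F is a homogeneous polynomial of degree d vanishing on Z that cannot be written as Σ_i Q_i F_i where the sum runs only over indices i with d_i < d, then F is part of a global regular sequence of c homogeneous equations defining Z. -/
open MvPolynomial

section helpers
open RingTheory.Sequence

lemma isWeaklyRegular_ofFn_iff' {R : Type*} [CommRing R] {c : ℕ} (F : Fin c → R) :
    IsWeaklyRegular R (List.ofFn F) ↔
    ∀ (i : Fin c) (p : R), F i * p ∈ Ideal.span (F '' {j | j < i}) → p ∈ Ideal.span (F '' {j | j < i}) := by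
  have key : ∀ i : Fin c, (Ideal.ofList ((List.ofFn F).take i) : Ideal R) = Ideal.span (F '' {j | j < i}) := by
    intro i
    unfold Ideal.ofList
    congr 1
    ext r
    simp only [Set.mem_ofPred_eq, Set.mem_image, List.mem_take_iff_getElem]
    constructor
    · rintro ⟨j, hj, rfl⟩
      simp at hj
      exact ⟨⟨j, by omega⟩, by exact hj, by simp⟩
    · rintro ⟨j, hj, rfl⟩
      exact ⟨j, by simpa using hj, by simp⟩
  rw [isWeaklyRegular_iff]
  constructor
  · intro h i p hp
    have := h i (by simp)
    rw [isSMulRegular_quotient_iff_mem_of_smul_mem] at this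
    simpa [key i] using this p (by simpa [key i] using hp)
  · intro h i hi
    rw [isSMulRegular_quotient_iff_mem_of_smul_mem]
    intro p hp
    have hi' : i < c := by simpa using hi
    have k := key ⟨i, hi'⟩
    simp only at k
    rw [k] at hp ⊢
    simpa using h ⟨i, hi'⟩ p (by simpa using hp)

lemma isRegular_X (k : Type*) [Field k] (n : ℕ) : IsRegular (MvPolynomial (Fin n) k) (List.ofFn (fun i : Fin n => (X i : MvPolynomial (Fin n) k))) := by
  have h1 : IsWeaklyRegular (MvPolynomial (Fin n) k) (List.ofFn (fun i : Fin n => (X i : MvPolynomial (Fin n) k))) := by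
    rw [isWeaklyRegular_ofFn_iff']
    intro i p hp
    rw [mem_ideal_span_X_image] at hp ⊢
    intro m hm
    obtain ⟨j, hj, h⟩ := hp (m + Finsupp.single i 1) (by
      rw [mem_support_iff, add_comm, coeff_X_mul]; exact mem_support_iff.mp hm)
    refine ⟨j, hj, ?_⟩
    have : j ≠ i := ne_of_lt hj
    simpa [Finsupp.single_apply, this.symm] using h
  refine ⟨h1, ?_⟩
  intro h
  have : (1 : MvPolynomial (Fin n) k) ∈ Ideal.span (X '' (Set.univ : Set (Fin n))) := by
    have h2 : (1 : MvPolynomial (Fin n) k) ∈ (⊤ : Ideal (MvPolynomial (Fin n) k)) := trivial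
    rw [h] at h2
    simpa [Ideal.ofList, Set.range] using h2
  rw [mem_ideal_span_X_image] at this
  simpa using this 0 (by simp)

section
open CategoryTheory Abelian Limits

lemma ext_vanish_quot {R : Type} [CommRing R] (N : ModuleCat.{0} R) (rs : List R) (n : ℕ)
    (M : ModuleCat.{0} R) (reg : IsWeaklyRegular M rs)
    (h : ∀ i < n + rs.length, Subsingleton (Ext N M i)) :
    ∀ i < n, Subsingleton (Ext N (ModuleCat.of R (M ⧸ (Ideal.ofList rs • ⊤ : Submodule R M))) i) := by
  induction rs generalizing M with
  | nil =>
    intro i hi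
    have e : (M ⧸ (Ideal.ofList [] • ⊤ : Submodule R M)) ≃ₗ[R] M :=
      Submodule.quotEquivOfEqBot (Ideal.ofList ([] : List R) • ⊤ : Submodule R M) (by
        rw [Ideal.ofList_nil, Submodule.bot_smul])
    have h3 : Subsingleton ((extFunctorObj N i).obj M) := h i (by simpa using hi)
    let e' : ModuleCat.of R (M ⧸ (Ideal.ofList [] • ⊤ : Submodule R M)) ≅ M := e.toModuleIso
    exact (((extFunctorObj N i).mapIso e').addCommGroupIsoToAddEquiv).toEquiv.subsingleton
  | cons r rs ih =>
    rw [isWeaklyRegular_cons_iff] at reg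
    have h' : ∀ i < n + rs.length, Subsingleton (Ext N (ModuleCat.of R (QuotSMulTop r M)) i) := by
      intro i hi
      have zero1 := AddCommGrpCat.isZero_of_iff_subsingleton.mpr (h i (by simp; omega))
      have zero2 := AddCommGrpCat.isZero_of_iff_subsingleton.mpr (h (i + 1) (by simp; omega))
      exact AddCommGrpCat.subsingleton_of_isZero <| ShortComplex.Exact.isZero_of_both_zeros
        ((Ext.covariant_sequence_exact₃' N reg.1.smulShortComplex_shortExact) i (i + 1) rfl)
        (zero1.eq_zero_of_src _) (zero2.eq_zero_of_tgt _)
    intro i hi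
    have h3 : Subsingleton ((extFunctorObj N i).obj (ModuleCat.of R (QuotSMulTop r M ⧸ (Ideal.ofList rs • ⊤ : Submodule R (QuotSMulTop r M))))) :=
      ih (ModuleCat.of R (QuotSMulTop r M)) reg.2 h' i hi
    let e' : ModuleCat.of R (M ⧸ (Ideal.ofList (r :: rs) • ⊤ : Submodule R M)) ≅
      ModuleCat.of R (QuotSMulTop r M ⧸ (Ideal.ofList rs • ⊤ : Submodule R (QuotSMulTop r M))) := 
      (Submodule.quotOfListConsSMulTopEquivQuotSMulTopInner M r rs).toModuleIso
    exact (((extFunctorObj N i).mapIso e').addCommGroupIsoToAddEquiv).toEquiv.subsingleton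

lemma depth_pos (k : Type) [Field k] (n : ℕ) (rs : List (MvPolynomial (Fin n) k)) (hl : rs.length < n)
    (reg : IsWeaklyRegular (MvPolynomial (Fin n) k) rs) (f : MvPolynomial (Fin n) k)
    (hf : ∀ i, X i * f ∈ Ideal.ofList rs) : f ∈ Ideal.ofList rs := by
  let R := MvPolynomial (Fin n) k
  let I : Ideal R := Ideal.span (Set.range X)
  have hIl : I = Ideal.ofList (List.ofFn (fun i : Fin n => (X i : MvPolynomial (Fin n) k))) := by
    simp [I, Ideal.ofList]; rfl
  have hsupp : Module.support R (R ⧸ I) = PrimeSpectrum.zeroLocus I := by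
    rw [Module.support_eq_zeroLocus, Ideal.annihilator_quotient]
  have h1 := ModuleCat.subsingleton_ext_of_exists_isRegular I (ModuleCat.of R (R ⧸ I)) hsupp.subset
    (ModuleCat.of R R) (by
      have := (isRegular_X k n).top_ne_smul
      rw [hIl]
      exact lt_top_iff_ne_top.mpr this.symm) _ (by
      intro r hr
      rw [hIl]
      exact Ideal.subset_span hr) (isRegular_X k n)
  have h2 := ext_vanish_quot (ModuleCat.of R (R ⧸ I)) rs 1 (ModuleCat.of R R) reg (by
    intro i hi
    exact h1 i (by simp; omega)) 0 (by simp)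
  have h3 : Subsingleton ((R ⧸ I) →ₗ[R] (R ⧸ (Ideal.ofList rs • ⊤ : Submodule R R))) :=
    (Ext.addEquiv₀.trans ModuleCat.homAddEquiv).subsingleton_congr.mp h2
  let φ : R →ₗ[R] (R ⧸ (Ideal.ofList rs • ⊤ : Submodule R R)) := LinearMap.toSpanSingleton R _ (Submodule.Quotient.mk f)
  have hφ : I ≤ LinearMap.ker φ := by
    rw [Ideal.span_le]
    rintro _ ⟨i, rfl⟩
    simp only [SetLike.mem_coe, LinearMap.mem_ker, φ, LinearMap.toSpanSingleton_apply]
    rw [← Submodule.Quotient.mk_smul, Submodule.Quotient.mk_eq_zero]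
    simpa using hf i
  have h4 : Submodule.liftQ I φ hφ = 0 := h3.elim _ _
  have h5 := congrArg (fun g => g (Submodule.Quotient.mk 1)) h4
  simp only [Submodule.liftQ_apply, φ, LinearMap.toSpanSingleton_apply, one_smul, LinearMap.zero_apply] at h5
  rw [Submodule.Quotient.mk_eq_zero] at h5
  simpa using h5

lemma exists_minor {K : Type} [Field K] {c n : ℕ} (A : Matrix (Fin c) (Fin n) K) (h : A.rank = c) :
    ∃ a : Fin c → Fin n, Function.Injective a ∧ (A.submatrix id a).det ≠ 0 := by
  obtain ⟨κ, a, ha, hs, hl⟩ := exists_linearIndependent' K A.col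
  have : Finite κ := Finite.of_injective a ha
  have := Fintype.ofFinite κ
  have h1 : Fintype.card κ = c := by
    rw [← finrank_span_eq_card hl, hs, ← Matrix.rank_eq_finrank_span_cols, h]
  let e : Fin c ≃ κ := (Fintype.equivFinOfCardEq h1).symm
  refine ⟨a ∘ e, ha.comp e.injective, ?_⟩
  have : LinearIndependent K (A.submatrix id (a ∘ e)).col := hl.comp e e.injective
  rw [Matrix.linearIndependent_cols_iff_isUnit, Matrix.isUnit_iff_isUnit_det] at this
  exact this.ne_zero

lemma etale_reduced (A : Type) [CommRing A] [IsDomain A] (B : Type) [CommRing B] [Algebra A B]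
    [Algebra.Etale A B] : IsReduced B := by
  let K := FractionRing A
  have h1 : IsReduced (TensorProduct A K B) := Algebra.FormallyUnramified.isReduced_of_field K _
  have h2 : Function.Injective (Algebra.TensorProduct.includeRight : B →ₐ[A] TensorProduct A K B) :=
    Algebra.TensorProduct.includeRight_injective (IsFractionRing.injective A K)
  exact isReduced_of_injective (Algebra.TensorProduct.includeRight : B →ₐ[A] TensorProduct A K B) h2

lemma reduced_of_jac (A : Type) [CommRing A] [IsDomain A] (σ : Type) [Fintype σ] [DecidableEq σ]
    (v : σ → MvPolynomial σ A)
    (h : IsUnit (Ideal.Quotient.mk (Ideal.span (Set.range v)) (Matrix.of fun i j => (v j).pderiv i).det)) :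
    IsReduced (MvPolynomial σ A ⧸ Ideal.span (Set.range v)) := by
  let P := Algebra.PreSubmersivePresentation.naive (v := v) id Function.injective_id
  let Q : Algebra.SubmersivePresentation A (MvPolynomial σ A ⧸ Ideal.span (Set.range v)) σ σ :=
    { P with 
      jacobian_isUnit := by
        show IsUnit P.jacobian
        rw [Algebra.PreSubmersivePresentation.jacobian_eq_jacobiMatrix_det]
        convert h using 1
        congr 2
        ext i j
        rw [Algebra.PreSubmersivePresentation.jacobiMatrix_naive]
        rfl }
  have := Q.isStandardSmoothOfRelativeDimension (n := 0) (by simp [Algebra.Presentation.dimension])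
  have : Algebra.Etale A (MvPolynomial σ A ⧸ Ideal.span (Set.range v)) := inferInstance
  exact etale_reduced A _

end

lemma local_aux (A : Type) [CommRing A] [IsDomain A] (c : ℕ) (v : Fin c → MvPolynomial (Fin c) A)
    (f : MvPolynomial (Fin c) A) (m : ℕ) (hf : f ^ m ∈ Ideal.span (Set.range v)) :
    ∃ s : ℕ, (Matrix.of fun i j => (v j).pderiv i).det ^ s * f ∈ Ideal.span (Set.range v) := by
  set g := (Matrix.of fun i j => (v j).pderiv i).det with hg
  set I := Ideal.span (Set.range v) with hI
  let ρ : MvPolynomial (Fin c) A →ₐ[A] MvPolynomial (Fin c ⊕ Unit) A := rename Sum.inl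
  let w : Fin c ⊕ Unit → MvPolynomial (Fin c ⊕ Unit) A :=
    Sum.elim (fun j => ρ (v j)) (fun _ => ρ g * X (Sum.inr ()) - 1)
  have hz : ∀ p, pderiv (Sum.inr ()) (ρ p) = 0 := by
    intro p
    apply pderiv_eq_zero_of_notMem_vars
    intro hmem
    have := vars_rename _ _ hmem
    simp at this
  have hdet : (Matrix.of fun i j => (w j).pderiv i).det = ρ g * ρ g := by
    have : (Matrix.of fun i j => (w j).pderiv i) = Matrix.fromBlocks
        ((Matrix.of fun i j => (v j).pderiv i).map ρ)
        (Matrix.of fun i _ => pderiv (Sum.inl i) (w (Sum.inr ())))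
        0 (Matrix.of fun _ _ => ρ g) := by
      ext1 i j
      rcases i with i | i <;> rcases j with j | j
      · simp only [Matrix.of_apply, Matrix.fromBlocks_apply₁₁, Matrix.map_apply, w, Sum.elim_inl]
        exact pderiv_rename Sum.inl_injective _ _
      · simp
      · simpa [w] using hz _
      · simp [w, hz]
    rw [this, Matrix.det_fromBlocks_zero₂₁]
    congr 1
    · rw [hg]; exact (AlgHom.map_det ρ _).symm
    · simp
  have hu : Ideal.Quotient.mk (Ideal.span (Set.range w)) (ρ g) * Ideal.Quotient.mk _ (X (Sum.inr ())) = 1 := by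
    rw [← map_mul, ← map_one (Ideal.Quotient.mk (Ideal.span (Set.range w))), Ideal.Quotient.eq]
    exact Ideal.subset_span ⟨Sum.inr (), rfl⟩
  have hun : IsUnit (Ideal.Quotient.mk (Ideal.span (Set.range w)) (ρ g)) := IsUnit.of_mul_eq_one _ hu
  have hred := reduced_of_jac A (Fin c ⊕ Unit) w (by
    rw [hdet, map_mul]; exact hun.mul hun)
  have hmap : I ≤ (Ideal.span (Set.range w)).comap ρ := by
    rw [hI, Ideal.span_le]
    rintro _ ⟨j, rfl⟩
    exact Ideal.subset_span ⟨Sum.inl j, rfl⟩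
  have hf' : ρ f ∈ Ideal.span (Set.range w) := by
    rw [← Ideal.Quotient.eq_zero_iff_mem]
    apply eq_zero_of_pow_eq_zero (n := m)
    rw [← map_pow, Ideal.Quotient.eq_zero_iff_mem, ← map_pow]
    exact hmap hf
  let gb : MvPolynomial (Fin c) A ⧸ I := Ideal.Quotient.mk I g
  let L := Localization.Away gb
  let τ : MvPolynomial (Fin c) A →ₐ[A] L :=
    (IsScalarTower.toAlgHom A (MvPolynomial (Fin c) A ⧸ I) L).comp (Ideal.Quotient.mkₐ A I)
  let ψ : MvPolynomial (Fin c ⊕ Unit) A →ₐ[A] L :=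
    aeval (Sum.elim (fun i => τ (X i)) (fun _ => IsLocalization.Away.invSelf gb))
  have hψ : ∀ p, ψ (ρ p) = τ p := by
    intro p
    have : ψ.comp ρ = τ := by
      ext i
      simp [ψ, ρ]
    exact DFunLike.congr_fun this p
  have hτ : ∀ p, τ p = algebraMap _ L (Ideal.Quotient.mk I p) := fun p => rfl
  have hk : Ideal.span (Set.range w) ≤ RingHom.ker ψ := by
    rw [Ideal.span_le]
    rintro _ ⟨j, rfl⟩
    rw [SetLike.mem_coe, RingHom.mem_ker]
    rcases j with j | j
    · simp only [w, Sum.elim_inl]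
      rw [hψ, hτ, Ideal.Quotient.eq_zero_iff_mem.mpr (Ideal.subset_span (Set.mem_range_self j)), map_zero]
    · simp only [w, Sum.elim_inr, map_sub, map_mul, map_one]
      rw [hψ, hτ]
      have : ψ (X (Sum.inr ())) = IsLocalization.Away.invSelf gb := by simp [ψ]
      rw [this, sub_eq_zero]
      exact IsLocalization.Away.mul_invSelf gb
  have h0 : algebraMap _ L (Ideal.Quotient.mk I f) = 0 := by
    rw [← hτ, ← hψ]; exact hk hf'
  rw [IsLocalization.map_eq_zero_iff (Submonoid.powers gb)] at h0
  obtain ⟨⟨_, s, rfl⟩, hs⟩ := h0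
  refine ⟨s, ?_⟩
  rw [← Ideal.Quotient.eq_zero_iff_mem, map_mul, map_pow]
  exact hs

lemma mem_span_equiv {R S : Type*} [CommRing R] [CommRing S] {c : ℕ} (φ : R ≃+* S) (F : Fin c → R) (p : R) :
    φ p ∈ Ideal.span (Set.range (fun i => φ (F i))) ↔ p ∈ Ideal.span (Set.range F) := by
  rw [Ideal.mem_span_range_iff_exists_fun, Ideal.mem_span_range_iff_exists_fun]
  constructor
  · rintro ⟨q, hq⟩
    refine ⟨fun i => φ.symm (q i), φ.injective ?_⟩
    rw [← hq]
    simp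
  · rintro ⟨q, hq⟩
    refine ⟨fun i => φ (q i), ?_⟩
    rw [← hq]
    simp

lemma local_nilp_aux (k : Type) [Field k] (n c : ℕ) (F : Fin c → MvPolynomial (Fin n) k)
    (a : Fin c → Fin n) (ha : Function.Injective a) (T : Type) (e : Fin n ≃ Fin c ⊕ T)
    (he : ∀ i, e (a i) = Sum.inl i) (f : MvPolynomial (Fin n) k) (m : ℕ)
    (hf : f ^ m ∈ Ideal.span (Set.range F)) :
    ∃ s : ℕ, (Matrix.of fun i j => (F i).pderiv (a j)).det ^ s * f ∈ Ideal.span (Set.range F) := by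
  obtain ⟨φ, hX, hC⟩ : ∃ φ : MvPolynomial (Fin n) k ≃ₐ[k] MvPolynomial (Fin c) (MvPolynomial T k),
      (∀ j, φ (X j) = Sum.elim (fun i => X i) (fun t => C (X t)) (e j)) ∧
      (∀ x, φ (C x) = C (C x)) := by
    refine ⟨(renameEquiv k e).trans (sumAlgEquiv k (Fin c) T), ?_, ?_⟩
    · intro j
      simp only [AlgEquiv.trans_apply, renameEquiv_apply, rename_X]
      rcases e j with i | t
      · exact sumRingEquiv_X_inl k (Fin c) T i
      · exact sumRingEquiv_X_inr k (Fin c) T t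
    · intro x
      simp only [AlgEquiv.trans_apply, renameEquiv_apply, rename_C]
      exact sumRingEquiv_C k (Fin c) T x
  have hd : ∀ i p, pderiv i (φ p) = φ (pderiv (a i) p) := by
    intro i p
    induction p using MvPolynomial.induction_on with
    | C x =>
      simp [hC]
    | add p q hp hq => simp [hp, hq]
    | mul_X p j hp =>
      rw [map_mul, Derivation.leibniz, Derivation.leibniz, hp, map_add, hX]
      simp only [smul_eq_mul, map_mul, hX]
      congr 2
      obtain ⟨y, rfl⟩ := e.symm.surjective j
      rw [Equiv.apply_symm_apply]
      rcases y with y | y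
      · have : e.symm (Sum.inl y) = a y := by rw [← he, Equiv.symm_apply_apply]
        rw [this]
        simp only [Sum.elim_inl, pderiv_X]
        by_cases h : i = y
        · subst h; simp
        · have : a i ≠ a y := fun h' => h (ha h')
          simp [Ne.symm this, Ne.symm h]
      · have : e.symm (Sum.inr y) ≠ a i := by
          intro h
          rw [Equiv.symm_apply_eq, he] at h
          cases h
        simp [pderiv_X, this]
  have hmem : ∀ p, φ p ∈ Ideal.span (Set.range (fun i => φ (F i))) ↔
      p ∈ Ideal.span (Set.range F) := fun p => mem_span_equiv φ.toRingEquiv F p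
  obtain ⟨s, hs⟩ := local_aux (MvPolynomial T k) c (fun i => φ (F i)) (φ f) m (by rw [← map_pow, hmem]; exact hf)
  refine ⟨s, ?_⟩
  rw [← hmem, map_mul, map_pow]
  convert hs using 3
  rw [← Matrix.det_transpose]
  rw [AlgEquiv.map_det]
  congr 1
  ext1 i j
  simp [hd]

lemma local_nilp (k : Type) [Field k] (n c : ℕ) (F : Fin c → MvPolynomial (Fin n) k)
    (a : Fin c → Fin n) (ha : Function.Injective a) (f : MvPolynomial (Fin n) k) (m : ℕ)
    (hf : f ^ m ∈ Ideal.span (Set.range F)) :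
    ∃ s : ℕ, (Matrix.of fun i j => (F i).pderiv (a j)).det ^ s * f ∈ Ideal.span (Set.range F) := by
  classical
  let T := ((Set.range a)ᶜ : Set (Fin n))
  let e : Fin n ≃ Fin c ⊕ T := ((Equiv.sumCongr (Equiv.ofInjective a ha) (Equiv.refl T)).trans
    (Equiv.Set.sumCompl (Set.range a))).symm
  refine local_nilp_aux k n c F a ha T e ?_ f m hf
  intro i
  rw [← Equiv.eq_symm_apply]
  simp only [e, Equiv.symm_symm, Equiv.trans_apply, Equiv.sumCongr_apply, Sum.map_inl]
  rw [Equiv.Set.sumCompl_apply_inl]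
  rfl

lemma ofList_ofFn {R : Type*} [CommRing R] {c : ℕ} (F : Fin c → R) :
    Ideal.ofList (List.ofFn F) = Ideal.span (Set.range F) := by
  simp [Ideal.ofList]; rfl

lemma mem_of_vanish (k : Type) [Field k] [IsAlgClosed k] (n c : ℕ) (hc : c < n)
    (F : Fin c → MvPolynomial (Fin n) k)
    (hreg : IsWeaklyRegular (MvPolynomial (Fin n) k) (List.ofFn F))
    (hsmooth : ∀ x : Fin n → k, x ≠ 0 → (∀ i, MvPolynomial.eval x (F i) = 0) →
      Matrix.rank (Matrix.of fun (i : Fin c) (j : Fin n) =>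
        MvPolynomial.eval x (MvPolynomial.pderiv j (F i))) = c)
    (G : MvPolynomial (Fin n) k)
    (hGvan : ∀ x : Fin n → k, (∀ i, MvPolynomial.eval x (F i) = 0) →
      MvPolynomial.eval x G = 0) : G ∈ Ideal.span (Set.range F) := by
  set I := Ideal.span (Set.range F) with hI
  have hrad : G ∈ I.radical := by
    rw [← vanishingIdeal_zeroLocus_eq_radical (K := k), mem_vanishingIdeal_iff]
    intro x hx
    rw [mem_zeroLocus_iff] at hx
    have := hGvan x (fun i => by simpa [aeval_eq_eval] using hx (F i) (Ideal.subset_span ⟨i, rfl⟩))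
    simpa [aeval_eq_eval] using this
  obtain ⟨m, hm⟩ := hrad
  let J : Ideal (MvPolynomial (Fin n) k) := I.colon {G}
  have hJ : ∀ p, p ∈ J ↔ p * G ∈ I := by
    intro p
    simp [J, Submodule.mem_colon]
  have hXrad : ∀ j, (X j : MvPolynomial (Fin n) k) ∈ J.radical := by
    intro j
    rw [← vanishingIdeal_zeroLocus_eq_radical (K := k), mem_vanishingIdeal_iff]
    intro x hx
    rw [mem_zeroLocus_iff] at hx
    by_cases h0 : x = 0
    · simp [h0]
    exfalso
    have hxF : ∀ i, eval x (F i) = 0 := by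
      intro i
      have : F i ∈ J := (hJ _).mpr (Ideal.mul_mem_right _ _ (Ideal.subset_span ⟨i, rfl⟩))
      simpa [aeval_eq_eval] using hx _ this
    obtain ⟨a, ha, hdet⟩ := exists_minor _ (hsmooth x h0 hxF)
    obtain ⟨s, hs⟩ := local_nilp k n c F a ha G m hm
    have h1 := hx _ ((hJ _).mpr hs)
    rw [map_pow] at h1
    have h2 := eq_zero_of_pow_eq_zero h1
    apply hdet
    rw [← h2, AlgHom.map_det]
    congr 1
  -- induction on monomials of the maximal ideal
  have hfin : ∃ N, (Ideal.span (Set.range (X : Fin n → MvPolynomial (Fin n) k))) ^ N ≤ J := by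
    apply Ideal.exists_pow_le_of_le_radical_of_fg
    · rw [Ideal.span_le]
      rintro _ ⟨j, rfl⟩
      exact hXrad j
    · exact IsNoetherian.noetherian _
  obtain ⟨N, hN⟩ := hfin
  have key : ∀ M : ℕ, ∀ f, (∀ p ∈ (Ideal.span (Set.range (X : Fin n → MvPolynomial (Fin n) k))) ^ M,
      p * f ∈ I) → f ∈ I := by
    intro M
    induction M with
    | zero => intro f hf; simpa using hf 1 (by simp)
    | succ M ih =>
      intro f hf
      rw [hI, ← ofList_ofFn]
      apply depth_pos k n _ (by simpa using hc) hreg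
      intro i
      rw [ofList_ofFn, ← hI]
      apply ih
      intro p hp
      rw [← mul_assoc]
      apply hf
      rw [pow_succ]
      exact Ideal.mul_mem_mul hp (Ideal.subset_span ⟨i, rfl⟩)
  exact key N G (fun p hp => (hJ p).mp (hN hp))

lemma hom_comp_mul {k : Type} [Field k] {n : ℕ} (p q : MvPolynomial (Fin n) k) (d e : ℕ)
    (hq : q.IsHomogeneous d) : homogeneousComponent e (p * q) =
      if d ≤ e then homogeneousComponent (e - d) p * q else 0 := by
  letI := MvPolynomial.gradedAlgebra (σ := Fin n) (R := k)
  have := DirectSum.coe_decompose_mul_of_right_mem (homogeneousSubmodule (Fin n) k) (a := p) (b := q) (i := d) e hq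
  have hdec : ∀ (φ : MvPolynomial (Fin n) k) (i : ℕ),
      (DirectSum.decompose (homogeneousSubmodule (Fin n) k) φ i : MvPolynomial (Fin n) k) =
        homogeneousComponent i φ := fun φ i => decomposition.decompose'_apply φ i
  rw [hdec, hdec] at this
  exact this

end helpers

theorem equation_part_of_global_regular_sequence
    (k : Type) [Field k] [IsAlgClosed k]
    (N c : ℕ) (hN : 2 ≤ N) (hc : c ≤ N - 1)
    (d : Fin c → ℕ) (hd : ∀ i, 2 ≤ d i) (hmono : Monotone d)
    (F : Fin c → MvPolynomial (Fin (N + 1)) k)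
    (hFhom : ∀ i, (F i).IsHomogeneous (d i))
    -- `F₁, …, F_c` is a global regular sequence defining the smooth `Z`
    (hreg : RingTheory.Sequence.IsRegular (MvPolynomial (Fin (N + 1)) k) (List.ofFn F))
    (hsmooth : ∀ x : Fin (N + 1) → k, x ≠ 0 → (∀ i, MvPolynomial.eval x (F i) = 0) →
      Matrix.rank (Matrix.of fun (i : Fin c) (j : Fin (N + 1)) =>
        MvPolynomial.eval x (MvPolynomial.pderiv j (F i))) = c)
    (e : ℕ) (G : MvPolynomial (Fin (N + 1)) k) (hGhom : G.IsHomogeneous e)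
    -- `G` vanishes on `Z`
    (hGvan : ∀ x : Fin (N + 1) → k, (∀ i, MvPolynomial.eval x (F i) = 0) →
      MvPolynomial.eval x G = 0)
    -- `G` is not `Σᵢ Qᵢ Fᵢ` with the sum over the indices `i` such that `dᵢ < e`
    (hGnot : ¬ ∃ Q : Fin c → MvPolynomial (Fin (N + 1)) k,
      G = ∑ i ∈ Finset.univ.filter (fun i => d i < e), Q i * F i) :
    ∃ (G' : Fin c → MvPolynomial (Fin (N + 1)) k) (i₀ : Fin c),
      (∀ i, (G' i).IsHomogeneous (d i)) ∧
      RingTheory.Sequence.IsRegular (MvPolynomial (Fin (N + 1)) k) (List.ofFn G') ∧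
      Ideal.span (Set.range G') = Ideal.span (Set.range F) ∧
      d i₀ = e ∧ G' i₀ = G := by
  classical
  have hGI := mem_of_vanish k (N + 1) c (by omega) F hreg.toIsWeaklyRegular hsmooth G hGvan
  rw [Ideal.mem_span_range_iff_exists_fun] at hGI
  obtain ⟨P, hP⟩ := hGI
  let Q : Fin c → MvPolynomial (Fin (N + 1)) k := fun i =>
    if d i ≤ e then homogeneousComponent (e - d i) (P i) else 0
  have hQ : G = ∑ i, Q i * F i := by
    have h1 := congrArg (homogeneousComponent e) hP
    rw [map_sum, homogeneousComponent_of_mem hGhom, if_pos rfl] at h1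
    rw [← h1]
    refine Finset.sum_congr rfl fun i _ => ?_
    rw [hom_comp_mul _ _ _ _ (hFhom i)]
    simp only [Q]
    split_ifs <;> simp
  -- the indices of degree `e` with nonzero coefficient
  let S : Finset (Fin c) := Finset.univ.filter (fun i => d i = e ∧ Q i ≠ 0)
  have hS : S.Nonempty := by
    by_contra hne
    rw [Finset.not_nonempty_iff_eq_empty] at hne
    apply hGnot
    refine ⟨Q, ?_⟩
    rw [hQ, Finset.sum_filter]
    refine Finset.sum_congr rfl fun i _ => ?_
    split_ifs with h
    · rfl
    · have : Q i = 0 := by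
        by_contra hQi
        have hle : d i ≤ e := by
          by_contra hle
          exact hQi (by simp [Q, hle])
        have : i ∈ S := by simp [S, hQi]; omega
        simp [hne] at this
      rw [this, zero_mul]
  let i₀ := S.max' hS
  have hi₀ : d i₀ = e ∧ Q i₀ ≠ 0 := by
    have := S.max'_mem hS
    simpa [S] using this
  obtain ⟨hdi, hQi⟩ := hi₀
  have hzero : ∀ i, i₀ < i → Q i = 0 := by
    intro i hi
    by_contra hne
    have hle : d i ≤ e := by
      by_contra hle
      exact hne (by simp [Q, hle])
    have hge := hmono hi.le
    have : i ∈ S := by simp [S, hne]; omega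
    exact absurd (S.le_max' i this) (not_le.mpr hi)
  obtain ⟨u, hu⟩ : ∃ u : k, Q i₀ = C u := by
    refine ⟨coeff 0 (P i₀), ?_⟩
    simp [Q, hdi, homogeneousComponent_zero]
  have hu0 : u ≠ 0 := by rintro rfl; simp [hu] at hQi
  clear_value i₀ Q
  -- lower part
  have hlow : G - C u * F i₀ ∈ Ideal.span (F '' {j | j < i₀}) := by
    have : G - C u * F i₀ = ∑ i ∈ Finset.univ.erase i₀, Q i * F i := by
      rw [hQ, ← Finset.add_sum_erase _ _ (Finset.mem_univ i₀), hu]; ring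
    rw [this]
    refine Ideal.sum_mem _ fun i hi => ?_
    rcases lt_trichotomy i i₀ with h | h | h
    · exact Ideal.mul_mem_left _ _ (Ideal.subset_span ⟨i, h, rfl⟩)
    · simp [h] at hi
    · rw [hzero i h, zero_mul]; exact Ideal.zero_mem _
  let G' := Function.update F i₀ G
  have hG'₀ : G' i₀ = G := by simp [G']
  have hG'ne : ∀ i, i ≠ i₀ → G' i = F i := fun i hi => by simp [G', hi]
  have himg : G' '' {j | j < i₀} = F '' {j | j < i₀} :=
    Set.image_congr fun j hj => hG'ne j (ne_of_lt hj)
  have hspan : ∀ T : Set (Fin c), (i₀ ∈ T → {j | j < i₀} ⊆ T) →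
      Ideal.span (G' '' T) = Ideal.span (F '' T) := by
    intro T hT
    by_cases hi : i₀ ∈ T
    swap
    · congr 1
      exact Set.image_congr fun j hj => hG'ne j (fun h => hi (h ▸ hj))
    have hsub := hT hi
    apply le_antisymm
    · rw [Ideal.span_le]
      rintro _ ⟨j, hj, rfl⟩
      by_cases h : j = i₀
      · subst h
        rw [hG'₀]
        have h1 := Ideal.span_mono (Set.image_mono hsub) hlow
        have h2 : C u * F j ∈ Ideal.span (F '' T) :=
          Ideal.mul_mem_left _ _ (Ideal.subset_span ⟨j, hj, rfl⟩)
        simpa using Ideal.add_mem _ h1 h2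
      · rw [hG'ne j h]; exact Ideal.subset_span ⟨j, hj, rfl⟩
    · rw [Ideal.span_le]
      rintro _ ⟨j, hj, rfl⟩
      by_cases h : j = i₀
      · subst h
        rw [← himg] at hlow
        have h1 := Ideal.span_mono (Set.image_mono hsub) hlow
        have h2 : G ∈ Ideal.span (G' '' T) := Ideal.subset_span ⟨j, hj, hG'₀⟩
        have h3 := Ideal.mul_mem_left _ (C u⁻¹) (Ideal.sub_mem _ h2 h1)
        have h4 : C u⁻¹ * (G - (G - C u * F j)) = F j := by
          rw [sub_sub_cancel, ← mul_assoc, ← C_mul, inv_mul_cancel₀ hu0, C_1, one_mul]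
        rw [h4] at h3
        exact h3
      · rw [← hG'ne j h]; exact Ideal.subset_span ⟨j, hj, rfl⟩
  have hrange : Ideal.span (Set.range G') = Ideal.span (Set.range F) := by
    have := hspan Set.univ (fun _ => Set.subset_univ _)
    simpa [Set.image_univ] using this
  refine ⟨G', i₀, ?_, ⟨?_, ?_⟩, hrange, hdi, hG'₀⟩
  · intro i
    by_cases h : i = i₀
    · subst h; rw [hG'₀, hdi]; exact hGhom
    · rw [hG'ne i h]; exact hFhom i
  · have hw := hreg.toIsWeaklyRegular
    rw [isWeaklyRegular_ofFn_iff'] at hw ⊢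
    intro i p hp
    have hs : Ideal.span (G' '' {j | j < i}) = Ideal.span (F '' {j | j < i}) :=
      hspan _ (fun hi j hj => show j < i from lt_trans (show j < i₀ from hj) (show i₀ < i from hi))
    rw [hs] at hp ⊢
    apply hw
    by_cases h : i = i₀
    · subst h
      rw [hG'₀] at hp
      have h3 := Ideal.mul_mem_left _ (C u⁻¹) (Ideal.sub_mem _ hp (Ideal.mul_mem_right p _ hlow))
      have h4 : C u⁻¹ * (G * p - (G - C u * F i) * p) = F i * p := by
        have : C u⁻¹ * (G * p - (G - C u * F i) * p) = (C u⁻¹ * C u) * (F i * p) := by ring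
        rw [this, ← C_mul, inv_mul_cancel₀ hu0, C_1, one_mul]
      rw [h4] at h3
      exact h3
    · rwa [hG'ne i h] at hp
  · have ht := hreg.top_ne_smul
    rw [ofList_ofFn] at ht ⊢
    rwa [hrange]
end
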